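/- arXiv:2207.08477 — 2 statements merged into one kernel-verified Lean document; each statement's English description precedes it below -/
import Mathlib

section
/- Let P = {x ∈ ℝⁿ : ⟨a_i, x⟩ ≤ 1, 1 ≤ i ≤ m} be an n-dimensional polytope given by an irredundant inequality description with 0 in its interior, and suppose P is centered, i.e., its centroid c(P) = vol(P)⁻¹ ∫_P x dx equals 0. Let A ⊆ ℝⁿ be an affine subspace. Then the sum of the cone volumes vol(C_i) over all indices i with a_i ∈ A satisfies Σ_{i : a_i ∈ A} vol(C_i) ≤ ((dim A + 1)/(n + 1)) · vol(P). -/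
open MeasureTheory Module
open scoped RealInnerProductSpace

section
open Set ENNReal
open scoped Pointwise

theorem volume_add_le_of_isCompact {A B S : Set ℝ} (hA : IsCompact A) (hB : IsCompact B)
    (hA0 : A.Nonempty) (hB0 : B.Nonempty) (h : ∀ x ∈ A, ∀ y ∈ B, x + y ∈ S) :
    volume A + volume B ≤ volume S := by
  obtain ⟨α, hα, hαm⟩ := hA.exists_isGreatest hA0
  obtain ⟨β, hβ, hβm⟩ := hB.exists_isLeast hB0
  have h1 : volume ((· + β) '' A) = volume A := by simp
  have h2 : volume ((α + ·) '' B) = volume B := by simp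
  have hnull : volume (((· + β) '' A) ∩ ((α + ·) '' B)) = 0 := by
    refine measure_mono_null (t := {α + β}) ?_ (by simp)
    rintro _ ⟨⟨x, hx, rfl⟩, ⟨y, hy, hxy⟩⟩
    have := hαm hx
    have := hβm hy
    simp only [mem_singleton_iff] at *
    linarith
  have hm : MeasurableSet ((α + ·) '' B) := (hB.image (by fun_prop)).measurableSet
  rw [← h1, ← h2, ← measure_union_add_inter _ hm, hnull, add_zero]
  refine measure_mono ?_
  rintro _ (⟨x, hx, rfl⟩ | ⟨y, hy, rfl⟩)
  · exact h _ hx _ hβ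
  · exact h _ hα _ hy

theorem volume_add_le {A B S : Set ℝ} (hA : MeasurableSet A) (hB : MeasurableSet B)
    (hA0 : A.Nonempty) (hB0 : B.Nonempty) (h : ∀ x ∈ A, ∀ y ∈ B, x + y ∈ S) :
    volume A + volume B ≤ volume S := by
  obtain ⟨α, hα⟩ := hA0
  obtain ⟨β, hβ⟩ := hB0
  by_contra! hlt
  by_cases hA1 : volume A = 0
  · refine hlt.not_ge ?_
    rw [hA1, zero_add, ← measure_preimage_add volume (-α) B]
    refine measure_mono fun y hy => ?_
    simpa using h α hα _ hy
  by_cases hB1 : volume B = 0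
  · refine hlt.not_ge ?_
    rw [hB1, add_zero, ← measure_preimage_add_right volume (-β) A]
    refine measure_mono fun y hy => ?_
    simpa using h _ hy β hβ
  obtain ⟨r, hr, s, hs, hrs⟩ := ENNReal.exists_lt_add_of_lt_add hlt hA1 hB1
  obtain ⟨K, hKA, hK, hrK⟩ := hA.exists_lt_isCompact hr
  obtain ⟨K', hKB, hK', hrK'⟩ := hB.exists_lt_isCompact hs
  have hK0 : K.Nonempty := nonempty_of_measure_ne_zero (ne_bot_of_gt hrK)
  have hK0' : K'.Nonempty := nonempty_of_measure_ne_zero (ne_bot_of_gt hrK')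
  have := volume_add_le_of_isCompact hK hK' hK0 hK0' fun x hx y hy => h x (hKA hx) y (hKB hy)
  exact (hrs.trans_le ((add_le_add hrK.le hrK'.le).trans this)).false

/-- A measure satisfies the Prékopa-Leindler inequality. -/
def IsPrekopaLeindler {E : Type*} [AddCommGroup E] [Module ℝ E] [MeasurableSpace E]
    (μ : Measure E) : Prop :=
  ∀ ⦃f g h : E → ℝ≥0∞⦄, Measurable f → Measurable g → Measurable h → ∀ ⦃a b : ℝ⦄,
    0 < a → 0 < b → a + b = 1 → (∀ x y, f x ^ a * g y ^ b ≤ h (a • x + b • y)) →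
    (∫⁻ x, f x ∂μ) ^ a * (∫⁻ x, g x ∂μ) ^ b ≤ ∫⁻ x, h x ∂μ

theorem lintegral_eq_lintegral_Ioo_meas_lt {f : ℝ → ℝ≥0∞} (hf : Measurable f)
    (hf1 : ∀ x, f x ≤ 1) :
    ∫⁻ x, f x = ∫⁻ t in Ioo (0 : ℝ) 1, volume {x | ENNReal.ofReal t < f x} := by
  have hfin : ∀ x, f x ≠ ∞ := fun x => ne_top_of_le_ne_top one_ne_top (hf1 x)
  have h := lintegral_eq_lintegral_meas_lt volume (f := fun x => (f x).toReal)
    (.of_forall fun x => toReal_nonneg) hf.ennreal_toReal.aemeasurable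
  simp only [ofReal_toReal (hfin _)] at h
  rw [h, ← Ioo_union_Ici_eq_Ioi (zero_lt_one (α := ℝ)),
    lintegral_union measurableSet_Ici (by
      rw [Set.disjoint_left]; intro x hx hx'; exact (hx.2.trans_le hx').false)]
  have h2 : ∫⁻ t in Ici (1 : ℝ), volume {x | t < (f x).toReal} = 0 := by
    rw [setLIntegral_congr_fun (g := fun _ => 0) measurableSet_Ici]
    · simp
    · intro t ht
      have : {x | t < (f x).toReal} = ∅ := by
        ext x
        have : (f x).toReal ≤ 1 := toReal_mono one_ne_top (hf1 x)
        simpa using this.trans ht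
      simp [this]
  rw [h2, add_zero]
  refine setLIntegral_congr_fun measurableSet_Ioo fun t ht => ?_
  simp only [ofReal_lt_iff_lt_toReal ht.1.le (hfin _)]

theorem rpow_mul_rpow_le_add {a b : ℝ} (ha : 0 < a) (hb : 0 < b) (hab : a + b = 1)
    (X Y : ℝ≥0∞) : X ^ a * Y ^ b ≤ ENNReal.ofReal a * X + ENNReal.ofReal b * Y := by
  have hpq : (a⁻¹).HolderConjugate b⁻¹ := by
    rw [Real.holderConjugate_iff]
    refine ⟨?_, by simpa using hab⟩
    rw [one_lt_inv₀ ha]; linarith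
  have := ENNReal.young_inequality (X ^ a) (Y ^ b) hpq
  rwa [← ENNReal.rpow_mul, ← ENNReal.rpow_mul, mul_inv_cancel₀ ha.ne', mul_inv_cancel₀ hb.ne',
    rpow_one, rpow_one, ofReal_inv_of_pos ha, ofReal_inv_of_pos hb, ENNReal.div_eq_inv_mul,
    ENNReal.div_eq_inv_mul, inv_inv, inv_inv] at this

theorem add_lintegral_le_of_iSup_eq_one {f g h : ℝ → ℝ≥0∞} (hf : Measurable f)
    (hg : Measurable g) (hh : Measurable h) {a b : ℝ} (ha : 0 < a) (hb : 0 < b) (hab : a + b = 1)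
    (H : ∀ x y, f x ^ a * g y ^ b ≤ h (a • x + b • y)) (hf1 : ⨆ x, f x = 1)
    (hg1 : ⨆ x, g x = 1) :
    ENNReal.ofReal a * (∫⁻ x, f x) + ENNReal.ofReal b * (∫⁻ x, g x) ≤ ∫⁻ x, h x := by
  have hfl : ∀ x, f x ≤ 1 := fun x => hf1 ▸ le_iSup f x
  have hgl : ∀ x, g x ≤ 1 := fun x => hg1 ▸ le_iSup g x
  have hmin : ∫⁻ x, min (h x) 1 ≤ ∫⁻ x, h x := lintegral_mono fun x => min_le_left _ _
  refine le_trans ?_ hmin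
  rw [lintegral_eq_lintegral_Ioo_meas_lt hf hfl, lintegral_eq_lintegral_Ioo_meas_lt hg hgl,
    lintegral_eq_lintegral_Ioo_meas_lt (hh.min measurable_const) fun x => min_le_right _ _,
    ← lintegral_const_mul' _ _ ofReal_ne_top, ← lintegral_const_mul' _ _ ofReal_ne_top]
  refine (le_lintegral_add _ _).trans ?_
  refine setLIntegral_mono' measurableSet_Ioo fun t ht => ?_
  have hA : ∀ {c : ℝ}, 0 < c → ∀ s : Set ℝ, ENNReal.ofReal c * volume s = volume (c • s) := by
    intro c hc s
    rw [Measure.addHaar_smul]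
    simp [abs_of_pos hc]
  rw [hA ha, hA hb]
  have ht1 : ENNReal.ofReal t < 1 := by simpa using ht.2
  refine volume_add_le ((measurableSet_lt measurable_const hf).const_smul₀ a)
    ((measurableSet_lt measurable_const hg).const_smul₀ b) ?_ ?_ ?_
  · obtain ⟨x, hx⟩ := lt_iSup_iff.1 (hf1 ▸ ht1)
    exact ⟨_, smul_mem_smul_set (a := a) (s := {x | ENNReal.ofReal t < f x}) hx⟩
  · obtain ⟨x, hx⟩ := lt_iSup_iff.1 (hg1 ▸ ht1)
    exact ⟨_, smul_mem_smul_set (a := b) (s := {x | ENNReal.ofReal t < g x}) hx⟩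
  · rintro _ ⟨x, hx, rfl⟩ _ ⟨y, hy, rfl⟩
    refine lt_min (lt_of_lt_of_le ?_ (H x y)) ht1
    have e : ENNReal.ofReal t = ENNReal.ofReal t ^ a * ENNReal.ofReal t ^ b := by
      rw [← ENNReal.rpow_add _ _ (by simpa using ht.1) ofReal_ne_top, hab, rpow_one]
    rw [e]
    exact ENNReal.mul_lt_mul (ENNReal.rpow_lt_rpow hx ha) (ENNReal.rpow_lt_rpow hy hb)

theorem rpow_lintegral_mul_le_of_iSup_ne_top {f g h : ℝ → ℝ≥0∞} (hf : Measurable f)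
    (hg : Measurable g) (hh : Measurable h) {a b : ℝ} (ha : 0 < a) (hb : 0 < b) (hab : a + b = 1)
    (H : ∀ x y, f x ^ a * g y ^ b ≤ h (a • x + b • y)) (hf1 : ⨆ x, f x ≠ ∞)
    (hg1 : ⨆ x, g x ≠ ∞) :
    (∫⁻ x, f x) ^ a * (∫⁻ x, g x) ^ b ≤ ∫⁻ x, h x := by
  set α := ⨆ x, f x with hα
  set β := ⨆ x, g x with hβ
  by_cases hα0 : α = 0
  · have : ∀ x, f x = 0 := by simpa [hα] using hα0
    simp [this, ha]
  by_cases hβ0 : β = 0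
  · have : ∀ x, g x = 0 := by simpa [hβ] using hβ0
    simp [this, hb]
  have key := add_lintegral_le_of_iSup_eq_one (f := fun x => α⁻¹ * f x) (g := fun x => β⁻¹ * g x)
    (h := fun x => (α⁻¹ ^ a * β⁻¹ ^ b) * h x) (hf.const_mul _) (hg.const_mul _) (hh.const_mul _)
    ha hb hab ?_ ?_ ?_
  · have := (rpow_mul_rpow_le_add ha hb hab _ _).trans key
    rw [lintegral_const_mul _ hf, lintegral_const_mul _ hg, lintegral_const_mul _ hh,
      ENNReal.mul_rpow_of_nonneg _ _ ha.le, ENNReal.mul_rpow_of_nonneg _ _ hb.le,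
      mul_mul_mul_comm] at this
    refine (ENNReal.mul_le_mul_iff_right ?_ ?_).1 this
    · simp [hf1, hg1, ha.not_gt, hb.not_gt]
    · refine ENNReal.mul_ne_top ?_ ?_
      · simp [hα0, ha.not_gt]
      · simp [hβ0, hb.not_gt]
  · intro x y
    rw [ENNReal.mul_rpow_of_nonneg _ _ ha.le, ENNReal.mul_rpow_of_nonneg _ _ hb.le,
      mul_mul_mul_comm]
    gcongr
    exact H x y
  · rw [← ENNReal.mul_iSup, ← hα, ENNReal.inv_mul_cancel hα0 hf1]
  · rw [← ENNReal.mul_iSup, ← hβ, ENNReal.inv_mul_cancel hβ0 hg1]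

theorem isPrekopaLeindler_real : IsPrekopaLeindler (volume : Measure ℝ) := by
  intro f g h hf hg hh a b ha hb hab H
  have trunc : ∀ {f : ℝ → ℝ≥0∞}, Measurable f →
      Filter.Tendsto (fun n : ℕ => ∫⁻ x, min (f x) n) Filter.atTop (nhds (∫⁻ x, f x)) := by
    intro f hf
    refine lintegral_tendsto_of_tendsto_of_monotone
      (fun n => (hf.min measurable_const).aemeasurable) ?_ ?_
    · exact .of_forall fun x m n hmn => min_le_min_left _ (by exact_mod_cast hmn)
    · refine .of_forall fun x => ?_
      simpa using (tendsto_const_nhds (x := f x)).min ENNReal.tendsto_nat_nhds_top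
  have bdd : ∀ (f : ℝ → ℝ≥0∞) (n : ℕ), ⨆ x, min (f x) n ≠ ∞ := fun f n =>
    ne_top_of_le_ne_top (natCast_ne_top n) (iSup_le fun x => min_le_right _ _)
  by_cases hf0 : ∫⁻ x, f x = 0
  · simp [hf0, ha]
  by_cases hg0 : ∫⁻ x, g x = 0
  · simp [hg0, hb]
  have lim := ENNReal.Tendsto.mul ((ENNReal.continuous_rpow_const (y := a)).tendsto _ |>.comp
    (trunc hf)) (.inl (by simp [hf0, ha, ha.not_gt])) ((ENNReal.continuous_rpow_const (y := b)).tendsto _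
    |>.comp (trunc hg)) (.inl (by simp [hg0, hb, hb.not_gt]))
  refine le_of_tendsto' lim fun n => ?_
  refine rpow_lintegral_mul_le_of_iSup_ne_top (hf.min measurable_const) (hg.min measurable_const)
    hh ha hb hab (fun x y => le_trans ?_ (H x y)) (bdd f n) (bdd g n)
  gcongr <;> exact min_le_left _ _

theorem IsPrekopaLeindler.prod {E F : Type*} [AddCommGroup E] [Module ℝ E] [MeasurableSpace E]
    [AddCommGroup F] [Module ℝ F] [MeasurableSpace F] {μ : Measure E} {ν : Measure F}
    [SFinite μ] [SFinite ν] (hμ : IsPrekopaLeindler μ) (hν : IsPrekopaLeindler ν) :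
    IsPrekopaLeindler (μ.prod ν) := by
  intro f g h hf hg hh a b ha hb hab H
  rw [lintegral_prod _ hf.aemeasurable, lintegral_prod _ hg.aemeasurable,
    lintegral_prod _ hh.aemeasurable]
  refine hμ hf.lintegral_prod_right' hg.lintegral_prod_right' hh.lintegral_prod_right' ha hb hab
    fun x y => ?_
  exact hν (by fun_prop) (by fun_prop) (by fun_prop) ha hb hab fun z w => H (x, z) (y, w)

theorem IsPrekopaLeindler.map {E F : Type*} [AddCommGroup E] [Module ℝ E] [MeasurableSpace E]
    [AddCommGroup F] [Module ℝ F] [MeasurableSpace F] {μ : Measure E} (hμ : IsPrekopaLeindler μ)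
    (L : E →ₗ[ℝ] F) (hL : Measurable L) : IsPrekopaLeindler (μ.map L) := by
  intro f g h hf hg hh a b ha hb hab H
  rw [lintegral_map hf hL, lintegral_map hg hL, lintegral_map hh hL]
  refine hμ (hf.comp hL) (hg.comp hL) (hh.comp hL) ha hb hab fun x y => ?_
  simpa using H (L x) (L y)

theorem IsPrekopaLeindler.smul {E : Type*} [AddCommGroup E] [Module ℝ E] [MeasurableSpace E]
    {μ : Measure E} (hμ : IsPrekopaLeindler μ) (c : ℝ≥0∞) (hc : c ≠ 0) (hc' : c ≠ ∞) :
    IsPrekopaLeindler (c • μ) := by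
  intro f g h hf hg hh a b ha hb hab H
  simp only [lintegral_smul_measure, smul_eq_mul]
  rw [ENNReal.mul_rpow_of_nonneg _ _ ha.le, ENNReal.mul_rpow_of_nonneg _ _ hb.le,
      mul_mul_mul_comm, ← ENNReal.rpow_add _ _ hc hc', hab, rpow_one]
  gcongr
  exact hμ hf hg hh ha hb hab H

theorem isPrekopaLeindler_pi (r : ℕ) : IsPrekopaLeindler (volume : Measure (Fin r → ℝ)) := by
  induction r with
  | zero =>
    intro f g h hf hg hh a b ha hb hab H
    have e : (volume : Measure (Fin 0 → ℝ)) = Measure.dirac 0 := by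
      rw [volume_pi, Measure.pi_of_empty _ 0]
    simpa [e] using H 0 0
  | succ r ih =>
    have e := (volume_preserving_piFinSuccAbove (fun _ : Fin (r + 1) => ℝ) 0).symm
    rw [← e.map_eq]
    exact (isPrekopaLeindler_real.prod ih).map
      { toFun := (MeasurableEquiv.piFinSuccAbove (fun _ : Fin (r + 1) => ℝ) 0).symm
        map_add' := by
          intro x y; ext i; refine Fin.cases ?_ (fun j => ?_) i <;> simp
        map_smul' := by
          intro c x; ext i; refine Fin.cases ?_ (fun j => ?_) i <;> simp }
      (MeasurableEquiv.piFinSuccAbove (fun _ : Fin (r + 1) => ℝ) 0).symm.measurable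

/-- The **Prékopa-Leindler inequality** for a Haar measure on a finite-dimensional space. -/
theorem isPrekopaLeindler_addHaar {E : Type*} [NormedAddCommGroup E] [NormedSpace ℝ E]
    [FiniteDimensional ℝ E] [MeasurableSpace E] [BorelSpace E] (μ : Measure E)
    [μ.IsAddHaarMeasure] : IsPrekopaLeindler μ := by
  let e : (Fin (finrank ℝ E) → ℝ) ≃L[ℝ] E :=
    ContinuousLinearEquiv.ofFinrankEq (by simp)
  have : (volume.map e.toLinearEquiv).IsAddHaarMeasure :=
    Measure.MapLinearEquiv.isAddHaarMeasure _ _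
  rw [Measure.isAddLeftInvariant_eq_smul μ (volume.map e.toLinearEquiv)]
  refine IsPrekopaLeindler.smul ?_ _ ?_ ?_
  · exact (isPrekopaLeindler_pi _).map e.toLinearEquiv.toLinearMap e.continuous.measurable
  · simpa using (Measure.addHaarScalarFactor_pos_of_isAddHaarMeasure _ _).ne'
  · simp

theorem ConcaveOn.exists_supergradient {V : Type*} [NormedAddCommGroup V] [NormedSpace ℝ V]
    [FiniteDimensional ℝ V] {K : Set V} (hK : IsOpen K) {ψ : V → ℝ} (hψ : ConcaveOn ℝ K ψ)
    {y₀ : V} (hy₀ : y₀ ∈ K) : ∃ p : V →L[ℝ] ℝ, ∀ y ∈ K, ψ y ≤ ψ y₀ + p (y - y₀) := by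
  have hconv := hψ.convex_strict_hypograph
  have hopen : IsOpen {z : V × ℝ | z.1 ∈ K ∧ z.2 < ψ z.1} := by
    have hc : ContinuousOn (fun z : V × ℝ => ψ z.1 - z.2) (Prod.fst ⁻¹' K) :=
      ((hψ.continuousOn hK).comp continuousOn_fst fun z hz => hz).sub continuousOn_snd
    convert hc.isOpen_inter_preimage (hK.preimage continuous_fst) isOpen_Ioi (t := Ioi 0) using 1
    ext z
    simp
  obtain ⟨F, hF⟩ := geometric_hahn_banach_open_point hconv hopen
    (x := (y₀, ψ y₀)) (by simp)
  have hsplit : ∀ y r, F (y, r) = F (y, 0) + r * F (0, 1) := by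
    intro y r
    rw [← smul_eq_mul, ← map_smul, ← map_add]
    simp
  have hc : 0 < F (0, 1) := by
    have := hF (y₀, ψ y₀ - 1) ⟨hy₀, by simp⟩
    rw [hsplit, hsplit y₀ (ψ y₀)] at this
    linarith
  refine ⟨-(F (0, 1))⁻¹ • F.comp (.inl ℝ V ℝ), fun y hy => ?_⟩
  have hle : F (y, ψ y) ≤ F (y₀, ψ y₀) := by
    have hlim : Filter.Tendsto (fun r : ℝ => F (y, r)) (nhdsWithin (ψ y) (Iio (ψ y)))
        (nhds (F (y, ψ y))) :=
      ((by fun_prop : Continuous fun r : ℝ => F (y, r)).tendsto _).mono_left nhdsWithin_le_nhds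
    refine le_of_tendsto hlim ?_
    filter_upwards [self_mem_nhdsWithin] with r hr
    exact (hF (y, r) ⟨hy, hr⟩).le
  rw [hsplit, hsplit y₀] at hle
  have hsub : F (y - y₀, 0) = F (y, 0) - F (y₀, 0) := by
    rw [← map_sub]; simp
  simp only [smul_apply, ContinuousLinearMap.comp_apply,
    ContinuousLinearMap.inl_apply, hsub, smul_eq_mul]
  have : F (0, 1) * (ψ y - ψ y₀ + (F (0, 1))⁻¹ * (F (y, 0) - F (y₀, 0))) ≤ 0 := by
    field_simp
    linarith
  nlinarith [nonpos_of_mul_nonpos_right this hc]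

/-- Let `f` be log-concave with barycenter `y₀`. Shrinking the support of `f` towards `y₀` by the
factor `1 - s` retains at least the fraction `(1 - s) ^ dim` of the mass. -/
theorem pow_mul_integral_le_setIntegral_of_logConcave {V : Type*} [NormedAddCommGroup V]
    [NormedSpace ℝ V] [FiniteDimensional ℝ V] [MeasurableSpace V] [BorelSpace V] (μ : Measure V)
    [μ.IsAddHaarMeasure] {K : Set V} (hK : IsOpen K) (hKc : Convex ℝ K) {f : V → ℝ}
    (hf : Integrable f μ) (hpos : ∀ y ∈ K, 0 < f y) (hzero : ∀ y ∉ K, f y = 0)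
    (hlog : ∀ x ∈ K, ∀ y ∈ K, ∀ a b : ℝ, 0 < a → 0 < b → a + b = 1 →
      f x ^ a * f y ^ b ≤ f (a • x + b • y))
    {y₀ : V} (hy₀ : y₀ ∈ K)
    (hbar : ∀ p : V →L[ℝ] ℝ, Integrable (fun y => f y * p y) μ ∧
      ∫ y, f y * p y ∂μ = (∫ y, f y ∂μ) * p y₀)
    {s : ℝ} (hs0 : 0 < s) (hs1 : s < 1) :
    (1 - s) ^ finrank ℝ V * ∫ y, f y ∂μ ≤
      ∫ y in (fun y => (1 - s) • y + s • y₀) '' K, f y ∂μ := by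
  have hs : 0 < 1 - s := by linarith
  have hψ : ConcaveOn ℝ K (fun y => Real.log (f y)) := by
    refine concaveOn_iff_forall_pos.2 ⟨hKc, fun x hx y hy a b ha hb hab => ?_⟩
    have h1 := Real.rpow_pos_of_pos (hpos x hx) a
    have h2 := Real.rpow_pos_of_pos (hpos y hy) b
    have := Real.log_le_log (by positivity) (hlog x hx y hy a b ha hb hab)
    rwa [Real.log_mul h1.ne' h2.ne', Real.log_rpow (hpos x hx), Real.log_rpow (hpos y hy)] at this
  obtain ⟨p, hp⟩ := hψ.exists_supergradient hK hy₀
  have hpt : ∀ y ∈ K, f y * (1 - s * p (y - y₀)) ≤ f ((1 - s) • y + s • y₀) := by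
    intro y hy
    refine le_trans ?_ (hlog y hy y₀ hy₀ (1 - s) s hs hs0 (by ring))
    have e : f y ^ (1 - s) * f y₀ ^ s =
        f y * Real.exp (s * (Real.log (f y₀) - Real.log (f y))) := by
      rw [Real.rpow_def_of_pos (hpos y hy), Real.rpow_def_of_pos (hpos y₀ hy₀), ← Real.exp_add]
      nth_rw 2 [← Real.exp_log (hpos y hy)]
      rw [← Real.exp_add]
      ring_nf
    rw [e]
    refine mul_le_mul_of_nonneg_left ?_ (hpos y hy).le
    have := Real.add_one_le_exp (s * (Real.log (f y₀) - Real.log (f y)))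
    nlinarith [hp y hy]
  set A : V → V := fun y => (1 - s) • y + s • y₀ with hA
  have hinjA : Function.Injective A := by
    intro x y hxy
    simpa [hA, hs.ne'] using hxy
  have hopenA : IsOpen (A '' K) := by
    have : A '' K = (fun y => (1 - s)⁻¹ • (y - s • y₀)) ⁻¹' K := by
      ext y
      constructor
      · rintro ⟨x, hx, rfl⟩
        simpa [hA, smul_smul, inv_mul_cancel₀ hs.ne'] using hx
      · intro hy
        exact ⟨_, hy, by simp [hA, smul_smul, mul_inv_cancel₀ hs.ne']⟩
    rw [this]
    exact hK.preimage (by fun_prop)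
  have hcomp : ∀ g : V → ℝ, ∫ y, g (A y) ∂μ = ((1 - s) ^ finrank ℝ V)⁻¹ * ∫ y, g y ∂μ := by
    intro g
    rw [Measure.integral_comp_smul μ (fun y => g (y + s • y₀)),
      integral_add_right_eq_self (μ := μ) g (s • y₀), abs_of_pos (by positivity), smul_eq_mul]
  have hint : Integrable (fun y => f y * (1 - s * p (y - y₀))) μ := by
    have : (fun y => f y * (1 - s * p (y - y₀))) =
        fun y => (1 + s * p y₀) * f y - s * (f y * p y) := by
      ext y; rw [map_sub]; ring
    rw [this]
    exact (hf.const_mul _).sub ((hbar p).1.const_mul _)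
  have hval : ∫ y, f y * (1 - s * p (y - y₀)) ∂μ = ∫ y, f y ∂μ := by
    have : (fun y => f y * (1 - s * p (y - y₀))) =
        fun y => (1 + s * p y₀) * f y - s * (f y * p y) := by
      ext y; rw [map_sub]; ring
    rw [this, integral_sub (hf.const_mul _) ((hbar p).1.const_mul _), integral_const_mul,
      integral_const_mul, (hbar p).2]
    ring
  have hfA : Integrable (fun y => (A '' K).indicator f (A y)) μ := by
    have h1 : Integrable ((A '' K).indicator f) μ := hf.indicator hopenA.measurableSet
    exact (h1.comp_add_right (s • y₀)).comp_smul hs.ne'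
  have hle : ∫ y, f y ∂μ ≤ ∫ y, (A '' K).indicator f (A y) ∂μ := by
    rw [← hval]
    refine integral_mono hint hfA fun y => ?_
    by_cases hy : y ∈ K
    · simpa [mem_image_of_mem A hy] using hpt y hy
    · simp [hinjA.mem_set_image, hy, hzero y hy]
  rw [hcomp, integral_indicator hopenA.measurableSet] at hle
  have h0 : 0 < (1 - s) ^ finrank ℝ V := by positivity
  calc _ ≤ (1 - s) ^ finrank ℝ V * _ := mul_le_mul_of_nonneg_left hle h0.le
    _ = _ := by rw [mul_inv_cancel_left₀ h0.ne']

theorem pow_mul_lintegral_le_setLIntegral_of_logConcave {V W : Type*} [NormedAddCommGroup V]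
    [NormedSpace ℝ V] [FiniteDimensional ℝ V] [MeasurableSpace V] [BorelSpace V] (μ : Measure V)
    [μ.IsAddHaarMeasure] [NormedAddCommGroup W]
    [NormedSpace ℝ W] [FiniteDimensional ℝ W] [MeasurableSpace W] [BorelSpace W] (ν : Measure W)
    [ν.IsAddHaarMeasure] {ρ : V × W → ℝ≥0∞} (hρ : Measurable ρ) (htop : ∀ z, ρ z ≠ ∞)
    (hlog : ∀ x y, ∀ a b : ℝ, 0 < a → 0 < b → a + b = 1 → ρ x ^ a * ρ y ^ b ≤ ρ (a • x + b • y))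
    (hopen : IsOpen {z | ρ z ≠ 0}) (hfin : ∫⁻ z, ρ z ∂μ.prod ν ≠ ∞)
    {y₀ : V} (hy₀ : y₀ ∈ Prod.fst '' {z | ρ z ≠ 0})
    (hbar : ∀ p : V →L[ℝ] ℝ, Integrable (fun z => (ρ z).toReal * p z.1) (μ.prod ν) ∧
      ∫ z, (ρ z).toReal * p z.1 ∂μ.prod ν = (∫ z, (ρ z).toReal ∂μ.prod ν) * p y₀)
    {s : ℝ} (hs0 : 0 < s) (hs1 : s < 1) :
    ENNReal.ofReal ((1 - s) ^ finrank ℝ V) * ∫⁻ z, ρ z ∂μ.prod ν ≤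
      ∫⁻ z in {z | ∃ x, ρ x ≠ 0 ∧ z.1 = (1 - s) • x.1 + s • y₀}, ρ z ∂μ.prod ν := by
  set K : Set V := Prod.fst '' {z | ρ z ≠ 0} with hKdef
  have hs : 0 < 1 - s := by linarith
  have hK : IsOpen K := isOpenMap_fst _ hopen
  have hKc : Convex ℝ K := by
    refine convex_iff_forall_pos.2 ?_
    rintro _ ⟨x, hx, rfl⟩ _ ⟨y, hy, rfl⟩ a b ha hb hab
    refine ⟨a • x + b • y, ?_, by simp⟩
    have := hlog x y a b ha hb hab
    intro h0
    rw [h0] at this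
    simp only [nonpos_iff_eq_zero, mul_eq_zero, ENNReal.rpow_eq_zero_iff, htop, false_and,
      or_false] at this
    rcases this with h | h
    exacts [hx h.1, hy h.1]
  set f : V → ℝ≥0∞ := fun y => ∫⁻ w, ρ (y, w) ∂ν with hfdef
  have hfm : Measurable f := hρ.lintegral_prod_right'
  have hflog : ∀ x y, ∀ a b : ℝ, 0 < a → 0 < b → a + b = 1 →
      f x ^ a * f y ^ b ≤ f (a • x + b • y) := fun x y a b ha hb hab =>
    isPrekopaLeindler_addHaar ν (by fun_prop) (by fun_prop) (by fun_prop) ha hb hab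
      fun w w' => hlog (x, w) (y, w') a b ha hb hab
  have hfpos : ∀ y ∈ K, f y ≠ 0 := by
    rintro _ ⟨⟨y, w⟩, hz, rfl⟩ h0
    rw [hfdef, lintegral_eq_zero_iff (by fun_prop)] at h0
    have ho : IsOpen {w | ρ (y, w) ≠ 0} := hopen.preimage (by fun_prop : Continuous (Prod.mk y))
    exact (ho.measure_pos ν ⟨w, hz⟩).ne' (ae_iff.1 h0)
  have hfzero : ∀ y ∉ K, f y = 0 := by
    intro y hy
    have : ∀ w, ρ (y, w) = 0 := by
      intro w
      by_contra h
      exact hy ⟨(y, w), h, rfl⟩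
    simp [hfdef, this]
  have hprod : ∫⁻ z, ρ z ∂μ.prod ν = ∫⁻ y, f y ∂μ := lintegral_prod _ hρ.aemeasurable
  have hftop : ∀ y, f y ≠ ∞ := by
    intro y
    by_cases hy : y ∈ K
    swap
    · simp [hfzero y hy]
    intro hy1
    refine hfin ?_
    rw [hprod, eq_top_iff]
    have ho : IsOpen ((fun u => (2 : ℝ) • u - y) ⁻¹' K) := hK.preimage (by fun_prop)
    have hm := ho.measure_pos μ ⟨y, by simpa [two_smul] using hy⟩
    calc ∞ = ∫⁻ u in ((fun u => (2 : ℝ) • u - y) ⁻¹' K), ∞ ∂μ := by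
          simp [ENNReal.top_mul, hm.ne']
      _ ≤ ∫⁻ u in ((fun u => (2 : ℝ) • u - y) ⁻¹' K), f u ∂μ := by
          refine setLIntegral_mono' ho.measurableSet fun u hu => ?_
          have := hflog y ((2 : ℝ) • u - y) (1 / 2) (1 / 2) (by norm_num) (by norm_num)
            (by norm_num)
          have e : (1 / 2 : ℝ) • y + (1 / 2 : ℝ) • ((2 : ℝ) • u - y) = u := by
            module
          rw [e, hy1, ENNReal.top_rpow_of_pos (by norm_num), ENNReal.top_mul] at this
          · exact this
          · simp [hfpos _ hu]
      _ ≤ _ := setLIntegral_le_lintegral _ _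
  have hint : ∀ y, ∫ w, (ρ (y, w)).toReal ∂ν = (f y).toReal := fun y =>
    integral_toReal (by fun_prop) (.of_forall fun w => (htop _).lt_top)
  have hρint : Integrable (fun z => (ρ z).toReal) (μ.prod ν) :=
    integrable_toReal_of_lintegral_ne_top hρ.aemeasurable hfin
  have hfint : Integrable (fun y => (f y).toReal) μ :=
    integrable_toReal_of_lintegral_ne_top hfm.aemeasurable (hprod ▸ hfin)
  have hmass : ∫ z, (ρ z).toReal ∂μ.prod ν = ∫ y, (f y).toReal ∂μ := by
    rw [integral_prod _ hρint]; simp [hint]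
  have key := pow_mul_integral_le_setIntegral_of_logConcave μ hK hKc hfint
    (fun y hy => toReal_pos (hfpos y hy) (hftop y)) (fun y hy => by simp [hfzero y hy]) ?_ hy₀ ?_
    hs0 hs1
  · have hopenA : MeasurableSet ((fun y => (1 - s) • y + s • y₀) '' K) := by
      have hemb : MeasurableEmbedding (fun y : V => (1 - s) • y + s • y₀) :=
        (measurableEmbedding_addRight (s • y₀)).comp (measurableEmbedding_const_smul₀ hs.ne')
      exact hemb.measurableSet_image.2 hK.measurableSet
    have hset : {z : V × W | ∃ x, ρ x ≠ 0 ∧ z.1 = (1 - s) • x.1 + s • y₀} =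
        Prod.fst ⁻¹' ((fun y => (1 - s) • y + s • y₀) '' K) := by
      ext z
      simp only [hKdef, mem_ofPred_eq, mem_preimage, mem_image, exists_exists_and_eq_and]
      simp only [eq_comm]
    have e : ∫⁻ z in Prod.fst ⁻¹' ((fun y => (1 - s) • y + s • y₀) '' K), ρ z ∂μ.prod ν =
        ∫⁻ y in (fun y => (1 - s) • y + s • y₀) '' K, f y ∂μ := by
      rw [← Set.prod_univ, ← Measure.prod_restrict, Measure.restrict_univ,
        lintegral_prod _ hρ.aemeasurable]
    rw [hset, e, hprod, ← ofReal_toReal (a := ∫⁻ y, f y ∂μ) (hprod ▸ hfin),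
      ← integral_toReal hfm.aemeasurable (.of_forall fun y => (hftop y).lt_top),
      ← ofReal_mul (by positivity)]
    refine ofReal_le_of_le_toReal (key.trans ?_)
    rw [integral_toReal hfm.aemeasurable (.of_forall fun y => (hftop y).lt_top)]
  · intro x hx y hy a b ha hb hab
    have := toReal_mono (hftop _) (hflog x y a b ha hb hab)
    rwa [toReal_mul, ← toReal_rpow, ← toReal_rpow] at this
  · intro p
    obtain ⟨h1, h2⟩ := hbar p
    have e : ∀ y, ∫ w, (ρ (y, w)).toReal * p y ∂ν = (f y).toReal * p y := fun y => by
      rw [integral_mul_const, hint]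
    refine ⟨?_, ?_⟩
    · simpa only [e] using h1.integral_prod_left
    · rw [← hmass, ← h2, integral_prod _ h1]
      simp only [e]

/-- The cone over `U × {1}` in `E × ℝ`, without its apex. -/
def coneOver {E : Type*} [AddCommGroup E] [Module ℝ E] (U : Set E) : Set (E × ℝ) :=
  {z | 0 < z.2 ∧ z.2⁻¹ • z.1 ∈ U}

theorem Convex.coneOver {E : Type*} [AddCommGroup E] [Module ℝ E] {U : Set E} (hU : Convex ℝ U) :
    Convex ℝ (coneOver U) := by
  refine convex_iff_forall_pos.2 ?_
  rintro ⟨x, t⟩ ⟨ht, hx⟩ ⟨y, r⟩ ⟨hr, hy⟩ a b ha hb hab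
  simp only at ht hx hr hy
  have hpos : 0 < a * t + b * r := by positivity
  refine ⟨by simpa using hpos, ?_⟩
  have := hU hx hy (a := a * t / (a * t + b * r)) (b := b * r / (a * t + b * r)) (by positivity)
    (by positivity) (by field_simp)
  convert this using 1
  simp only [Prod.fst_add, Prod.smul_fst, Prod.snd_add, Prod.smul_snd, smul_eq_mul, smul_add,
    smul_smul]
  congr 2 <;> field_simp

theorem IsOpen.coneOver {E : Type*} [NormedAddCommGroup E] [NormedSpace ℝ E] {U : Set E}
    (hU : IsOpen U) : IsOpen (coneOver U) := by
  have hc : ContinuousOn (fun z : E × ℝ => z.2⁻¹ • z.1) {z | 0 < z.2} :=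
    (continuousOn_snd.inv₀ fun z hz => ne_of_gt hz).smul continuousOn_fst
  exact hc.isOpen_inter_preimage (isOpen_lt continuous_const continuous_snd) hU

section Cone

variable {E : Type*} [NormedAddCommGroup E] [NormedSpace ℝ E] [FiniteDimensional ℝ E]
  [MeasurableSpace E] [BorelSpace E] (μ : Measure E) [μ.IsAddHaarMeasure]

theorem MeasurableSet.coneOver {U : Set E} (hU : MeasurableSet U) :
    MeasurableSet (coneOver U) := by
  have : Measurable fun z : E × ℝ => z.2⁻¹ • z.1 := by fun_prop
  exact (measurableSet_lt measurable_const measurable_snd).inter (this hU)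

theorem setLIntegral_coneOver {U : Set E} (hU : MeasurableSet U) {φ : ℝ → ℝ≥0∞}
    (hφ : Measurable φ) :
    ∫⁻ z in coneOver U, φ z.2 ∂μ.prod volume =
      (∫⁻ t in Ioi 0, φ t * ENNReal.ofReal (t ^ finrank ℝ E)) * μ U := by
  rw [← lintegral_indicator hU.coneOver, lintegral_prod_symm _
    ((by fun_prop : Measurable fun z : E × ℝ => φ z.2).indicator hU.coneOver).aemeasurable,
    ← lintegral_mul_const _ (by fun_prop), ← lintegral_indicator measurableSet_Ioi]
  refine lintegral_congr fun t => ?_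
  by_cases ht : 0 < t
  · have hset : (fun x : E => (x, t)) ⁻¹' _root_.coneOver U = t • U := by
      ext x
      simp [_root_.coneOver, ht, mem_smul_set_iff_inv_smul_mem₀ ht.ne']
    have e : ∀ x, (_root_.coneOver U).indicator (fun z => φ z.2) (x, t) =
        (t • U).indicator (fun _ => φ t) x := by
      intro x
      rw [← hset]
      rfl
    simp only [e]
    rw [lintegral_indicator (hU.const_smul₀ t), setLIntegral_const,
      Measure.addHaar_smul_of_nonneg μ ht.le, indicator_of_mem (by exact ht), mul_assoc]
  · have e : ∀ x, (_root_.coneOver U).indicator (fun z => φ z.2) (x, t) = 0 := fun x =>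
      indicator_of_notMem (fun h => ht h.1) _
    simp [e, ht]

theorem lintegral_exp_neg_mul_pow (n : ℕ) :
    ∫⁻ t in Ioi (0 : ℝ), ENNReal.ofReal (Real.exp (-t)) * ENNReal.ofReal (t ^ n) =
      ENNReal.ofReal n.factorial := by
  have h := Real.GammaIntegral_convergent (s := n + 1) (by positivity)
  rw [← Real.Gamma_nat_eq_factorial, Real.Gamma_eq_integral (by positivity),
    ofReal_integral_eq_lintegral_ofReal h]
  · refine setLIntegral_congr_fun measurableSet_Ioi fun t ht => ?_
    rw [add_sub_cancel_right, Real.rpow_natCast, ofReal_mul (Real.exp_pos _).le]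
  · filter_upwards [ae_restrict_mem measurableSet_Ioi] with t ht
    have : 0 < t := ht
    simp only [Pi.zero_apply]
    positivity

theorem setLIntegral_coneOver_exp {U : Set E} (hU : MeasurableSet U) :
    ∫⁻ z in coneOver U, ENNReal.ofReal (Real.exp (-z.2)) ∂μ.prod volume =
      ENNReal.ofReal (finrank ℝ E).factorial * μ U := by
  rw [setLIntegral_coneOver μ hU (φ := fun t => ENNReal.ofReal (Real.exp (-t))) (by fun_prop),
    lintegral_exp_neg_mul_pow]

theorem integrableOn_coneOver_exp {U : Set E} (hU : MeasurableSet U)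
    (hb : Bornology.IsBounded U) (q : E × ℝ →L[ℝ] ℝ) :
    IntegrableOn (fun z => Real.exp (-z.2) * q z) (coneOver U) (μ.prod volume) := by
  obtain ⟨R, hR0, hR⟩ := hb.exists_pos_norm_le
  refine ⟨by fun_prop, ?_⟩
  have hm := setLIntegral_coneOver μ hU
    (φ := fun t => ENNReal.ofReal (Real.exp (-t)) * ENNReal.ofReal (‖q‖ * max R 1) *
      ENNReal.ofReal t) (by fun_prop)
  refine lt_of_le_of_lt (b := ∫⁻ z in _root_.coneOver U, ENNReal.ofReal (Real.exp (-z.2)) *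
    ENNReal.ofReal (‖q‖ * max R 1) * ENNReal.ofReal z.2 ∂μ.prod volume) ?_ ?_
  · refine setLIntegral_mono' hU.coneOver ?_
    rintro ⟨x, t⟩ ⟨ht, hx⟩
    simp only at ht hx
    have hxt : ‖x‖ ≤ R * t := by
      have := hR _ hx
      rwa [norm_smul, norm_inv, Real.norm_of_nonneg ht.le, inv_mul_le_iff₀ ht, mul_comm] at this
    have hn : ‖(x, t)‖ ≤ max R 1 * t := by
      rw [Prod.norm_def, max_mul_of_nonneg _ _ ht.le, one_mul]
      exact max_le_max hxt (Real.norm_of_nonneg ht.le).le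
    rw [← ofReal_mul (Real.exp_pos _).le, ← ofReal_mul (by positivity), ← ofReal_norm]
    refine ofReal_le_ofReal ?_
    rw [norm_mul, Real.norm_of_nonneg (Real.exp_pos _).le, mul_assoc, mul_assoc]
    gcongr
    exact (q.le_opNorm _).trans (by gcongr)
  · rw [hm]
    refine mul_lt_top ?_ hb.measure_lt_top
    have e : ∀ t ∈ Ioi (0 : ℝ), ENNReal.ofReal (Real.exp (-t)) *
        ENNReal.ofReal (‖q‖ * max R 1) * ENNReal.ofReal t * ENNReal.ofReal (t ^ finrank ℝ E) =
        ENNReal.ofReal (‖q‖ * max R 1) *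
          (ENNReal.ofReal (Real.exp (-t)) * ENNReal.ofReal (t ^ (finrank ℝ E + 1))) := by
      intro t ht
      rw [pow_succ', ofReal_mul (le_of_lt ht)]
      ring
    rw [setLIntegral_congr_fun measurableSet_Ioi e, lintegral_const_mul _ (by fun_prop),
      lintegral_exp_neg_mul_pow]
    exact mul_lt_top ofReal_lt_top ofReal_lt_top

theorem setIntegral_coneOver_exp_mul {U : Set E} (hU : MeasurableSet U)
    (hb : Bornology.IsBounded U) (hcent : ∫ x in U, x ∂μ = 0) (q : E × ℝ →L[ℝ] ℝ) :
    ∫ z in coneOver U, Real.exp (-z.2) * q z ∂μ.prod volume =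
      (finrank ℝ E).factorial * μ.real U * q (0, finrank ℝ E + 1) := by
  set n := finrank ℝ E with hn
  have hint := integrableOn_coneOver_exp μ hU hb q
  rw [← integral_indicator hU.coneOver, integral_prod_symm _ (hint.integrable_indicator hU.coneOver)]
  have hidU : IntegrableOn (fun x : E => x) U μ :=
    Measure.integrableOn_of_bounded hb.measure_lt_top.ne (by fun_prop)
      (hb.exists_norm_le.choose_spec |> fun h => (ae_restrict_mem hU).mono h)
  have hqU : ∫ x in U, q (x, 1) ∂μ = μ.real U * q (0, 1) := by
    have e : ∀ x, q (x, 1) = q.comp (.inl ℝ E ℝ) x + q (0, 1) := by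
      intro x
      rw [ContinuousLinearMap.comp_apply, ContinuousLinearMap.inl_apply, ← map_add]
      simp
    have hconst : IntegrableOn (fun _ : E => q (0, 1)) U μ :=
      integrableOn_const hb.measure_lt_top.ne
    rw [integral_congr_ae (.of_forall e), integral_add (ContinuousLinearMap.integrable_comp _ hidU) hconst,
      ContinuousLinearMap.integral_comp_comm _ hidU, hcent, map_zero, setIntegral_const,
      zero_add, smul_eq_mul]
  have hslice : ∀ t : ℝ, ∫ x, (coneOver U).indicator (fun z => Real.exp (-z.2) * q z) (x, t) ∂μ =
      (Ioi (0 : ℝ)).indicator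
        (fun t => Real.exp (-t) * t ^ ((n + 2 : ℝ) - 1) * (μ.real U * q (0, 1))) t := by
    intro t
    by_cases ht : 0 < t
    · have e : ∀ x, (_root_.coneOver U).indicator (fun z => Real.exp (-z.2) * q z) (x, t) =
          (fun x => U.indicator (fun x => Real.exp (-t) * t * q (x, 1)) x) (t⁻¹ • x) := by
        intro x
        have : q (x, t) = t * q (t⁻¹ • x, 1) := by
          rw [← smul_eq_mul, ← map_smul]
          simp [smul_smul, ht.ne']
        by_cases hx : t⁻¹ • x ∈ U
        · have hz : (x, t) ∈ _root_.coneOver U := ⟨ht, hx⟩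
          simp only [indicator_of_mem hx, indicator_of_mem hz, this, mul_assoc]
        · have hz : (x, t) ∉ _root_.coneOver U := fun h => hx h.2
          simp only [indicator_of_notMem hx, indicator_of_notMem hz]
      simp only [e]
      rw [Measure.integral_comp_inv_smul μ
        (fun x => U.indicator (fun x => Real.exp (-t) * t * q (x, 1)) x), integral_indicator hU,
        integral_const_mul, hqU, indicator_of_mem (by exact ht), abs_of_pos (by positivity),
        show ((n : ℝ) + 2 - 1) = ((n + 1 : ℕ) : ℝ) by push_cast; ring, Real.rpow_natCast,
        smul_eq_mul, pow_succ]
      ring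
    · have e : ∀ x, (_root_.coneOver U).indicator (fun z => Real.exp (-z.2) * q z) (x, t) = 0 :=
        fun x => indicator_of_notMem (fun h => ht h.1) _
      simp [e, ht]
  simp only [hslice]
  rw [integral_indicator measurableSet_Ioi, integral_mul_const,
    ← Real.Gamma_eq_integral (by positivity),
    show ((n : ℝ) + 2) = ((n + 1 : ℕ) : ℝ) + 1 by push_cast; ring, Real.Gamma_nat_eq_factorial,
    Nat.factorial_succ]
  have : q (0, (n : ℝ) + 1) = (n + 1) * q (0, 1) := by
    rw [← smul_eq_mul, ← map_smul]
    simp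
  rw [this]
  push_cast
  ring

/-- A concentration inequality for projections of the cone over a centered convex body, endowed
with the exponential weight. -/
theorem pow_mul_measure_le_setLIntegral_coneOver {V : Type*} [NormedAddCommGroup V]
    [NormedSpace ℝ V] [FiniteDimensional ℝ V] {U : Set E} (hU : IsOpen U) (hUc : Convex ℝ U)
    (hb : Bornology.IsBounded U) (h0 : 0 ∈ U) (hcent : ∫ x in U, x ∂μ = 0)
    (π : E × ℝ →L[ℝ] V) (hπ : Function.Surjective π) {s : ℝ} (hs0 : 0 < s) (hs1 : s < 1) :
    ENNReal.ofReal ((1 - s) ^ finrank ℝ V) * (ENNReal.ofReal (finrank ℝ E).factorial * μ U) ≤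
      ∫⁻ z in {z | z ∈ coneOver U ∧ ∃ x ∈ coneOver U,
        π z = (1 - s) • π x + s • π (0, finrank ℝ E + 1)},
        ENNReal.ofReal (Real.exp (-z.2)) ∂μ.prod volume := by
  let _ : MeasurableSpace V := borel V
  have _ : BorelSpace V := ⟨rfl⟩
  obtain ⟨π', hπ'⟩ := π.toLinearMap.exists_rightInverse_of_surjective
    (LinearMap.range_eq_top.2 hπ)
  let e : (E × ℝ) ≃L[ℝ] V × π.ker :=
    ContinuousLinearEquiv.equivOfRightInverse π π'.toContinuousLinearMap
      fun v => congrArg (fun f => f v) hπ'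
  have he : ∀ z, (e z).1 = π z := fun z => rfl
  let μV : Measure V := Measure.addHaar
  let μW : Measure π.ker := Measure.addHaar
  let T : (V × π.ker) ≃ᵐ (E × ℝ) := e.symm.toHomeomorph.toMeasurableEquiv
  have hT : ∀ z, T z = e.symm z := fun z => rfl
  obtain ⟨c, hc0, hctop, hc⟩ : ∃ c : ℝ≥0∞, c ≠ 0 ∧ c ≠ ∞ ∧
      (μV.prod μW).map T = c • (μ.prod volume) := by
    have : ((μV.prod μW).map e.symm.toLinearEquiv).IsAddHaarMeasure :=
      Measure.MapLinearEquiv.isAddHaarMeasure _ _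
    have h := Measure.isAddLeftInvariant_eq_smul
      ((μV.prod μW).map e.symm.toLinearEquiv) (μ.prod volume)
    refine ⟨_, ?_, ?_, h⟩
    · simpa using (Measure.addHaarScalarFactor_pos_of_isAddHaarMeasure _ _).ne'
    · simp
  let ρ : E × ℝ → ℝ≥0∞ := (coneOver U).indicator fun z => ENNReal.ofReal (Real.exp (-z.2))
  have hρm : Measurable ρ := by
    refine Measurable.indicator ?_ hU.coneOver.measurableSet
    fun_prop
  have hρ0 : ∀ z, ρ z ≠ 0 ↔ z ∈ coneOver U := by
    intro z
    simp [ρ, Real.exp_pos]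
  have hρlog : ∀ x y, ∀ a b : ℝ, 0 < a → 0 < b → a + b = 1 →
      ρ x ^ a * ρ y ^ b ≤ ρ (a • x + b • y) := by
    intro x y a b ha hb' hab
    by_cases hx : x ∈ coneOver U
    swap
    · simp [ρ, hx, ha]
    by_cases hy : y ∈ coneOver U
    swap
    · simp [ρ, hy, hb']
    have hxy := hUc.coneOver hx hy ha.le hb'.le hab
    simp only [ρ, indicator_of_mem hx, indicator_of_mem hy, indicator_of_mem hxy]
    rw [ofReal_rpow_of_pos (Real.exp_pos _), ofReal_rpow_of_pos (Real.exp_pos _),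
      ← ofReal_mul (by positivity), ← Real.exp_mul, ← Real.exp_mul, ← Real.exp_add]
    refine le_of_eq ?_
    congr 2
    simp
    ring
  have hρint : ∫⁻ z, ρ z ∂μ.prod volume = ENNReal.ofReal (finrank ℝ E).factorial * μ U := by
    rw [lintegral_indicator hU.coneOver.measurableSet,
      setLIntegral_coneOver_exp μ hU.measurableSet]
  have hρreal : ∀ z, (ρ z).toReal = (coneOver U).indicator (fun z => Real.exp (-z.2)) z := by
    intro z
    by_cases hz : z ∈ coneOver U <;> simp [ρ, hz, Real.exp_nonneg]
  have hTint : ∫⁻ z, ρ (T z) ∂μV.prod μW = c * ∫⁻ z, ρ z ∂μ.prod volume := by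
    rw [← lintegral_map_equiv ρ T, hc, lintegral_smul_measure, smul_eq_mul]
  have hfin : ∫⁻ z, ρ z ∂μ.prod volume ≠ ∞ := by
    rw [hρint]
    exact mul_ne_top ofReal_ne_top hb.measure_lt_top.ne
  have hz₀ : ((0 : E), (finrank ℝ E : ℝ) + 1) ∈ coneOver U :=
    ⟨by simp only; positivity, by simpa using h0⟩
  have key := pow_mul_lintegral_le_setLIntegral_of_logConcave μV μW (ρ := fun z => ρ (T z))
    (hρm.comp T.measurable) (fun z => by
      by_cases hz : T z ∈ coneOver U <;> simp [ρ, hz])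
    (fun x y a b ha hb' hab => by simpa [hT] using hρlog (T x) (T y) a b ha hb' hab)
    (by
      simp only [hρ0]
      exact hU.coneOver.preimage e.symm.continuous)
    (by rw [hTint]; exact mul_ne_top hctop hfin)
    (y₀ := π (0, finrank ℝ E + 1))
    ⟨e (0, finrank ℝ E + 1), by simpa only [mem_ofPred_eq, hρ0, hT, e.symm_apply_apply], he _⟩
    ?_ hs0 hs1
  · have hset : ∫⁻ z in {z | ∃ x, ρ (T x) ≠ 0 ∧ z.1 = (1 - s) • x.1 +
        s • π (0, finrank ℝ E + 1)}, ρ (T z) ∂μV.prod μW =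
        c * ∫⁻ z in {z | ∃ x ∈ coneOver U,
        π z = (1 - s) • π x + s • π (0, finrank ℝ E + 1)}, ρ z ∂μ.prod volume := by
      rw [← smul_eq_mul, ← lintegral_smul_measure, ← Measure.restrict_smul, ← hc,
        T.restrict_map, lintegral_map_equiv]
      congr 2
      ext z
      simp only [mem_ofPred_eq, mem_preimage, hρ0, hT]
      constructor
      · rintro ⟨x, hx, h⟩
        refine ⟨_, hx, ?_⟩
        rw [← he, ← he (e.symm x)]
        simpa using h
      · rintro ⟨x, hx, h⟩
        refine ⟨e x, by simpa using hx, ?_⟩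
        rw [he, ← h, ← he]
        simp
    rw [hset, hTint, mul_left_comm] at key
    have key' := (ENNReal.mul_le_mul_iff_right hc0 hctop).1 key
    rw [hρint] at key'
    refine key'.trans (le_of_eq ?_)
    rw [setLIntegral_indicator hU.coneOver.measurableSet]
    rfl
  · intro p
    have e1 : (fun z => (ρ (T z)).toReal * p z.1) =
        fun z => (fun z => (ρ z).toReal * p (π z)) (T z) := by
      ext z
      simp only [hT]
      rw [← he (e.symm z), e.apply_symm_apply]
    have e2 : (fun z => (ρ z).toReal * p (π z)) =
        (coneOver U).indicator fun z => Real.exp (-z.2) * p.comp π z := by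
      ext z
      rw [hρreal]
      by_cases hz : z ∈ coneOver U <;> simp [hz]
    have hi := (integrableOn_coneOver_exp μ hU.measurableSet hb
      (p.comp π)).integrable_indicator hU.coneOver.measurableSet
    rw [e1]
    constructor
    · refine (integrable_map_equiv T (fun z => (ρ z).toReal * p (π z))).1 ?_
      rw [hc, e2]
      exact hi.smul_measure hctop
    · rw [← integral_map_equiv T (fun z => (ρ z).toReal * p (π z)),
        ← integral_map_equiv T (fun z => (ρ z).toReal), hc, integral_smul_measure,
        integral_smul_measure, e2, integral_indicator hU.coneOver.measurableSet,
        setIntegral_coneOver_exp_mul μ hU.measurableSet hb hcent,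
        integral_toReal hρm.aemeasurable (.of_forall fun z => by
          by_cases hz : z ∈ coneOver U <;> simp [ρ, hz]), hρint, toReal_mul,
        toReal_ofReal (by positivity)]
      simp only [smul_eq_mul, Measure.real, ContinuousLinearMap.comp_apply]
      ring

end Cone

section Polytope

variable {E : Type*} [NormedAddCommGroup E] [InnerProductSpace ℝ E] {ι : Type*}

/-- The cone of points at which `⟪a i, ·⟫` is the largest of the functionals `⟪a j, ·⟫`. -/
def maxCone (a : ι → E) (i : ι) : Set E := {x | ∀ j, ⟪a j, x⟫ ≤ ⟪a i, x⟫}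

theorem isClosed_maxCone (a : ι → E) (i : ι) : IsClosed (maxCone a i) := by
  simp only [maxCone, ofPred_forall]
  exact isClosed_iInter fun j => isClosed_le (by fun_prop) (by fun_prop)

theorem smul_mem_maxCone_iff {a : ι → E} {i : ι} {t : ℝ} (ht : 0 < t) {x : E} :
    t • x ∈ maxCone a i ↔ x ∈ maxCone a i := by
  simp [maxCone, inner_smul_right, ht]

theorem convex_maxCone (a : ι → E) (i : ι) : Convex ℝ (maxCone a i) := by
  intro x hx y hy b c hb hc hbc j
  simp only [inner_add_right, inner_smul_right]
  exact add_le_add (mul_le_mul_of_nonneg_left (hx j) hb) (mul_le_mul_of_nonneg_left (hy j) hc)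

theorem convex_setOf_inner_le (a : ι → E) : Convex ℝ {x | ∀ i, ⟪a i, x⟫ ≤ 1} := by
  intro x hx y hy b c hb hc hbc j
  simp only [inner_add_right, inner_smul_right]
  have := mul_le_mul_of_nonneg_left (hx j) hb
  have := mul_le_mul_of_nonneg_left (hy j) hc
  linarith

theorem convex_setOf_inner_lt (a : ι → E) : Convex ℝ {x | ∀ i, ⟪a i, x⟫ < 1} := by
  refine convex_iff_forall_pos.2 fun x hx y hy b c hb hc hbc j => ?_
  simp only [inner_add_right, inner_smul_right]
  have := mul_lt_mul_of_pos_left (hx j) hb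
  have := mul_lt_mul_of_pos_left (hy j) hc
  linarith

theorem convexHull_facet_subset (a : ι → E) (i : ι) :
    convexHull ℝ ({0} ∪ ({x | ∀ j, ⟪a j, x⟫ ≤ 1} ∩ {x | ⟪a i, x⟫ = 1})) ⊆
      {x | ∀ j, ⟪a j, x⟫ ≤ 1} ∩ maxCone a i := by
  refine convexHull_min ?_ ((convex_setOf_inner_le a).inter (convex_maxCone a i))
  rintro x (rfl | ⟨hx, hxi⟩)
  · exact ⟨by simp, by simp [maxCone]⟩
  · exact ⟨hx, fun j => (hx j).trans hxi.ge⟩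

theorem inner_nonneg_of_mem_maxCone {a : ι → E}
    (hbd : Bornology.IsBounded {x | ∀ j, ⟪a j, x⟫ ≤ 1}) {i : ι} {x : E} (hx : x ∈ maxCone a i) :
    0 ≤ ⟪a i, x⟫ := by
  by_contra! hneg
  have hx0 : x ≠ 0 := by
    rintro rfl
    simp at hneg
  obtain ⟨R, hR0, hR⟩ := hbd.exists_pos_norm_le
  have hmem : ((R + 1) / ‖x‖) • x ∈ {x | ∀ j, ⟪a j, x⟫ ≤ 1} := by
    intro j
    rw [inner_smul_right]
    have h1 : ⟪a j, x⟫ ≤ 0 := (hx j).trans hneg.le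
    have h2 : 0 ≤ (R + 1) / ‖x‖ := by positivity
    linarith [mul_nonpos_of_nonneg_of_nonpos h2 h1]
  have := hR _ hmem
  rw [norm_smul, Real.norm_of_nonneg (by positivity),
    div_mul_cancel₀ _ (norm_ne_zero_iff.2 hx0)] at this
  linarith

theorem isOpen_setOf_inner_lt [Finite ι] (a : ι → E) : IsOpen {x | ∀ i, ⟪a i, x⟫ < 1} := by
  simp only [ofPred_forall]
  exact isOpen_iInter_of_finite fun j => isOpen_lt (by fun_prop) (by fun_prop)

variable [FiniteDimensional ℝ E] [MeasurableSpace E] [BorelSpace E]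

theorem addHaar_setOf_inner_eq (μ : Measure E) [μ.IsAddHaarMeasure] {v : E} (hv : v ≠ 0) (c : ℝ) :
    μ {x | ⟪v, x⟫ = c} = 0 := by
  have h := Measure.addHaar_affineSubspace μ
    (AffineSubspace.comap (innerₗ E v).toAffineMap (AffineSubspace.mk' c ⊥)) ?_
  · convert h using 2
    ext x
    simp [sub_eq_zero]
  · intro htop
    have h1 : (0 : E) ∈ AffineSubspace.comap (innerₗ E v).toAffineMap (AffineSubspace.mk' c ⊥) :=
      htop ▸ AffineSubspace.mem_top ..
    have h2 : v ∈ AffineSubspace.comap (innerₗ E v).toAffineMap (AffineSubspace.mk' c ⊥) :=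
      htop ▸ AffineSubspace.mem_top ..
    simp [sub_eq_zero] at h1 h2
    rw [h1] at h2
    simp [hv] at h2

variable [Fintype ι]

theorem setOf_inner_lt_ae_eq (μ : Measure E) [μ.IsAddHaarMeasure] {a : ι → E}
    (ha0 : ∀ i, a i ≠ 0) :
    ({x | ∀ i, ⟪a i, x⟫ < 1} : Set E) =ᵐ[μ] {x | ∀ i, ⟪a i, x⟫ ≤ 1} := by
  have h : ∀ᵐ x ∂μ, ∀ i, ⟪a i, x⟫ ≠ 1 := by
    refine ae_all_iff.2 fun i => ?_
    rw [ae_iff]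
    simpa using addHaar_setOf_inner_eq μ (ha0 i) 1
  filter_upwards [h] with x hx
  exact propext ⟨fun h i => (h i).le, fun h i => lt_of_le_of_ne (h i) (hx i)⟩

theorem sum_measure_convexHull_facet_le (μ : Measure E) [μ.IsAddHaarMeasure] {a : ι → E}
    (hinj : Function.Injective a) (ha0 : ∀ i, a i ≠ 0) (I : Finset ι) :
    ∑ i ∈ I, μ (convexHull ℝ ({0} ∪ ({x | ∀ j, ⟪a j, x⟫ ≤ 1} ∩ {x | ⟪a i, x⟫ = 1}))) ≤
      μ ({x | ∀ j, ⟪a j, x⟫ < 1} ∩ ⋃ i ∈ I, maxCone a i) := by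
  have hU := (isOpen_setOf_inner_lt a).measurableSet
  have hG : ∀ i, MeasurableSet (maxCone a i) := fun i => (isClosed_maxCone a i).measurableSet
  rw [inter_iUnion₂, measure_biUnion_finset₀]
  · refine Finset.sum_le_sum fun i _ => (measure_mono (convexHull_facet_subset a i)).trans ?_
    exact (measure_congr ((setOf_inner_lt_ae_eq μ ha0).inter (ae_eq_refl (maxCone a i)))).ge
  · intro i _ j _ hij
    refine measure_mono_null (t := {x | ⟪a i - a j, x⟫ = 0}) ?_
      (addHaar_setOf_inner_eq μ (sub_ne_zero.2 (hinj.ne hij)) 0)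
    rintro x ⟨⟨_, hi⟩, ⟨_, hj⟩⟩
    simp only [mem_ofPred_eq, inner_sub_left, sub_eq_zero]
    exact le_antisymm (hj i) (hi j)
  · exact fun i _ => (hU.inter (hG i)).nullMeasurableSet

/-- For a centered polytope and outer normals `a i`, `i ∈ I`, in an affine subspace of dimension
`k`, the part of the polytope outside the cones over the facets with index in `I`, together with
`exp (-s (n + 1))` times the rest, has at least `(1 - s) ^ (k + 1)` of the total volume. -/
theorem pow_mul_measure_le_of_mem_affineSubspace (μ : Measure E) [μ.IsAddHaarMeasure] {a : ι → E}
    (hbd : Bornology.IsBounded {x | ∀ j, ⟪a j, x⟫ ≤ 1})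
    (hcent : ∫ x in {x | ∀ j, ⟪a j, x⟫ < 1}, x ∂μ = 0) (A : AffineSubspace ℝ E) {I : Finset ι}
    (hI : ∀ i ∈ I, a i ∈ A) (hA : (A : Set E).Nonempty) {s : ℝ} (hs0 : 0 < s) (hs1 : s < 1) :
    ENNReal.ofReal ((1 - s) ^ (finrank ℝ A.direction + 1)) * μ {x | ∀ j, ⟪a j, x⟫ < 1} ≤
      μ ({x | ∀ j, ⟪a j, x⟫ < 1} \ ⋃ i ∈ I, maxCone a i) +
      ENNReal.ofReal (Real.exp (-(s * (finrank ℝ E + 1)))) *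
        μ ({x | ∀ j, ⟪a j, x⟫ < 1} ∩ ⋃ i ∈ I, maxCone a i) := by
  obtain ⟨p, hp⟩ := hA
  set U : Set E := {x | ∀ j, ⟪a j, x⟫ < 1} with hUdef
  set G : Set E := ⋃ i ∈ I, maxCone a i with hGdef
  set n := finrank ℝ E with hn
  have hU : IsOpen U := isOpen_setOf_inner_lt a
  have hGm : MeasurableSet G :=
    Finset.measurableSet_biUnion _ fun i _ => (isClosed_maxCone a i).measurableSet
  have hUb : Bornology.IsBounded U := hbd.subset fun x hx j => (hx j).le
  let π : E × ℝ →L[ℝ] A.direction × ℝ :=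
    (A.direction.orthogonalProjectionOnto.comp (.fst ℝ E ℝ)).prod
      ((innerSL ℝ p).comp (.fst ℝ E ℝ) - .snd ℝ E ℝ)
  have hπ : Function.Surjective π := by
    rintro ⟨v, r⟩
    refine ⟨((v : E), ⟪p, (v : E)⟫ - r), ?_⟩
    simp [π]
  have hfac : ∀ i ∈ I, ∀ z : E × ℝ,
      ⟪a i, z.1⟫ - z.2 = ⟪a i - p, ((π z).1 : E)⟫ + (π z).2 := by
    intro i hi z
    have hd : a i - p ∈ A.direction := A.vsub_mem_direction (hI i hi) hp
    have : ⟪a i - p, (A.direction.orthogonalProjectionOnto z.1 : E)⟫ = ⟪a i - p, z.1⟫ :=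
      A.direction.inner_orthogonalProjectionOnto_eq_of_mem_left ⟨_, hd⟩ z.1
    simp only [π, ContinuousLinearMap.prod_apply, ContinuousLinearMap.comp_apply,
      ContinuousLinearMap.coe_fst', this, sub_apply, ContinuousLinearMap.coe_snd', innerSL_apply_apply,
      inner_sub_left]
    ring
  have key := pow_mul_measure_le_setLIntegral_coneOver μ hU (convex_setOf_inner_lt a) hUb
    (by simp [hUdef]) hcent π hπ hs0 hs1
  have hsub : {z | z ∈ coneOver U ∧ ∃ x ∈ coneOver U,
        π z = (1 - s) • π x + s • π (0, (n : ℝ) + 1)} ⊆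
      coneOver (U \ G) ∪ {z | z + (0, -(s * (n + 1))) ∈ coneOver (U ∩ G)} := by
    rintro ⟨y, t⟩ ⟨⟨ht, hy⟩, ⟨⟨x, r⟩, ⟨hr, hx⟩, h⟩⟩
    simp only at ht hy hr hx
    by_cases hyG : t⁻¹ • y ∈ G
    swap
    · exact .inl ⟨ht, hy, hyG⟩
    right
    have hlt : ∀ i ∈ I, ⟪a i, y⟫ < t - s * (n + 1) := by
      intro i hi
      have h1 := hfac i hi (y, t)
      have h2 := hfac i hi (x, r)
      have h3 := hfac i hi (0, n + 1)
      rw [h] at h1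
      simp only [Prod.fst_add, Prod.smul_fst, Prod.snd_add, Prod.smul_snd, Submodule.coe_add,
        Submodule.coe_smul, inner_add_right, inner_smul_right, smul_eq_mul, inner_zero_right]
        at h1 h2 h3
      have h4 := hx i
      rw [inner_smul_right, inv_mul_lt_iff₀ hr, mul_one] at h4
      nlinarith [mul_lt_mul_of_pos_left h4 (sub_pos.2 hs1)]
    simp only [hGdef, mem_iUnion] at hyG
    obtain ⟨i, hi, hyi⟩ := hyG
    have hyi' := (smul_mem_maxCone_iff (inv_pos.2 ht)).1 hyi
    have hpos : 0 < t - s * (n + 1) :=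
      (inner_nonneg_of_mem_maxCone hbd hyi').trans_lt (hlt i hi)
    have hpos' : 0 < t + -(s * (n + 1)) := by linarith
    refine ⟨by simpa using hpos, ?_, ?_⟩
    · intro j
      simp only [Prod.mk_add_mk, add_zero]
      rw [inner_smul_right, inv_mul_lt_iff₀ hpos', mul_one]
      linarith [hyi' j, hlt i hi]
    · simp only [Prod.mk_add_mk, add_zero, hGdef, mem_iUnion]
      exact ⟨i, hi, (smul_mem_maxCone_iff (inv_pos.2 hpos')).2 hyi'⟩
  have hshift : ∫⁻ z in {z | z + (0, -(s * (n + 1))) ∈ coneOver (U ∩ G)},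
      ENNReal.ofReal (Real.exp (-z.2)) ∂μ.prod volume =
      ENNReal.ofReal (Real.exp (-(s * (n + 1)))) *
        (ENNReal.ofReal n.factorial * μ (U ∩ G)) := by
    have hm : MeasurableSet (coneOver (U ∩ G)) := (hU.measurableSet.inter hGm).coneOver
    have hm' : MeasurableSet {z : E × ℝ | z + (0, -(s * (n + 1))) ∈ coneOver (U ∩ G)} :=
      hm.preimage (measurable_add_const _)
    rw [← setLIntegral_coneOver_exp μ (hU.measurableSet.inter hGm),
      ← lintegral_const_mul _ (by fun_prop), ← lintegral_indicator hm', ← lintegral_indicator hm,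
      ← lintegral_add_right_eq_self ((coneOver (U ∩ G)).indicator fun z =>
        ENNReal.ofReal (Real.exp (-(s * (n + 1)))) * ENNReal.ofReal (Real.exp (-z.2)))
        ((0 : E), -(s * (n + 1)))]
    refine lintegral_congr fun z => ?_
    by_cases hz : z + (0, -(s * (n + 1))) ∈ coneOver (U ∩ G)
    · rw [indicator_of_mem (by exact hz), indicator_of_mem hz, ← ofReal_mul (Real.exp_pos _).le,
        ← Real.exp_add]
      congr 2
      simp
    · rw [indicator_of_notMem (by exact hz), indicator_of_notMem hz]
  have hfin := key.trans ((lintegral_mono_set hsub).trans (lintegral_union_le _ _ _))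
  rw [hshift, setLIntegral_coneOver_exp μ (hU.measurableSet.diff hGm), mul_left_comm,
    mul_left_comm (ENNReal.ofReal (Real.exp _)), ← mul_add] at hfin
  have hdim : finrank ℝ (A.direction × ℝ) = finrank ℝ A.direction + 1 := by simp
  rw [hdim] at hfin
  exact (ENNReal.mul_le_mul_iff_right (by simp [Nat.factorial_ne_zero]) ofReal_ne_top).1 hfin

end Polytope

theorem mul_le_mul_of_forall_one_sub_pow {k : ℕ} {c B M : ℝ} (hc : 0 < c)
    (hM : 0 ≤ M)
    (h : ∀ s : ℝ, 0 < s → s < 1 → (1 - s) ^ k * M ≤ M - B + Real.exp (-(s * c)) * B)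
    (hB : 0 ≤ B) : c * B ≤ k * M := by
  have hs : ∀ s ∈ Ioo (0 : ℝ) 1, c * B ≤ k * M * (1 + s * c) := by
    rintro s ⟨hs0, hs1⟩
    have h1 := h s hs0 hs1
    have h2 : 1 + k * (-s) ≤ (1 + (-s)) ^ k := one_add_mul_le_pow (by linarith) k
    rw [← sub_eq_add_neg] at h2
    have h3 : Real.exp (-(s * c)) ≤ 1 / (1 + s * c) := by
      rw [Real.exp_neg, ← one_div]
      exact one_div_le_one_div_of_le (by positivity) (by linarith [Real.add_one_le_exp (s * c)])
    have h4 := mul_le_mul_of_nonneg_right h2 hM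
    have h5 := mul_le_mul_of_nonneg_right h3 hB
    have h6 : B - 1 / (1 + s * c) * B ≤ s * (k * M) := by linarith
    have h7 : B - 1 / (1 + s * c) * B = s * (c * B / (1 + s * c)) := by
      field_simp
      ring
    rw [h7] at h6
    have h8 := le_of_mul_le_mul_left h6 hs0
    rwa [div_le_iff₀ (by positivity)] at h8
  have hlim : Filter.Tendsto (fun s : ℝ => k * M * (1 + s * c)) (nhdsWithin 0 (Ioi 0))
      (nhds (k * M)) := by
    have : Continuous fun s : ℝ => k * M * (1 + s * c) := by fun_prop
    simpa using (this.tendsto 0).mono_left (nhdsWithin_le_nhds (s := Ioi 0))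
  refine ge_of_tendsto hlim ?_
  filter_upwards [Ioo_mem_nhdsGT (zero_lt_one (α := ℝ))] with s h using hs s h

end

open Classical in
/-- **Affine subspace concentration inequality** for centered polytopes:
if `P = {x | ⟪a i, x⟫ ≤ 1}` is a centered `n`-dimensional polytope
(irredundant description, `0 ∈ int P`) and `A` is an affine subspace, then
`∑_{i : a i ∈ A} vol(C i) ≤ ((dim A + 1)/(n+1)) · vol(P)`, where
`C i = conv({0} ∪ F i)` is the cone over the facet `F i = P ∩ {x | ⟪a i, x⟫ = 1}`. -/
theorem affine_subspace_concentration
    (n m : ℕ) (a : Fin m → EuclideanSpace ℝ (Fin n))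
    (P : Set (EuclideanSpace ℝ (Fin n)))
    (hP : P = {x | ∀ i, ⟪a i, x⟫ ≤ 1})
    (hbd : Bornology.IsBounded P)
    (h0 : (0 : EuclideanSpace ℝ (Fin n)) ∈ interior P)
    (hinj : Function.Injective a)
    (ha0 : ∀ i, a i ≠ 0)
    (hirr : ∀ i, ∃ x, (∀ j, j ≠ i → ⟪a j, x⟫ ≤ 1) ∧ 1 < ⟪a i, x⟫)
    (hcent : (volume P).toReal⁻¹ • (∫ x in P, x) = 0)
    (A : AffineSubspace ℝ (EuclideanSpace ℝ (Fin n))) :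
    ∑ i ∈ Finset.univ.filter (fun i => a i ∈ A),
        (volume (convexHull ℝ ({0} ∪ (P ∩ {x | ⟪a i, x⟫ = 1})))).toReal
      ≤ ((finrank ℝ A.direction + 1 : ℝ) / (n + 1)) * (volume P).toReal := by
  rcases (A : Set (EuclideanSpace ℝ (Fin n))).eq_empty_or_nonempty with hA | hA
  · rw [Finset.sum_eq_zero]
    · positivity
    · intro i hi
      have : a i ∈ (A : Set (EuclideanSpace ℝ (Fin n))) := (Finset.mem_filter.1 hi).2
      simp [hA] at this
  have hPpos : (volume P).toReal ≠ 0 :=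
    (ENNReal.toReal_pos (Measure.measure_pos_of_mem_nhds volume (mem_interior_iff_mem_nhds.1 h0)).ne'
      hbd.measure_lt_top.ne).ne'
  have hcent' : ∫ x in P, x = 0 := (smul_eq_zero.1 hcent).resolve_left (inv_ne_zero hPpos)
  subst hP
  set U : Set (EuclideanSpace ℝ (Fin n)) := {x | ∀ i, ⟪a i, x⟫ < 1} with hU
  set I := Finset.univ.filter fun i => a i ∈ A with hI
  set G := ⋃ i ∈ I, maxCone a i with hG
  have hae := setOf_inner_lt_ae_eq volume ha0
  have hUfin : volume U ≠ ⊤ := (hbd.subset fun x hx j => (hx j).le).measure_lt_top.ne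
  have hGm : MeasurableSet G :=
    Finset.measurableSet_biUnion _ fun i _ => (isClosed_maxCone a i).measurableSet
  have hcone := sum_measure_convexHull_facet_le volume hinj ha0 I
  rw [setIntegral_congr_set hae.symm] at hcent'
  have hsum : ∑ i ∈ I, (volume (convexHull ℝ ({0} ∪ ({x | ∀ j, ⟪a j, x⟫ ≤ 1} ∩
      {x | ⟪a i, x⟫ = 1})))).toReal ≤ volume.real (U ∩ G) := by
    rw [← ENNReal.toReal_sum]
    · exact ENNReal.toReal_mono (measure_ne_top_of_subset Set.inter_subset_left hUfin) hcone
    · exact fun i _ => measure_ne_top_of_subset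
        ((convexHull_facet_subset a i).trans Set.inter_subset_left) hbd.measure_lt_top.ne
  refine hsum.trans ?_
  rw [← measure_congr hae, div_mul_eq_mul_div, le_div_iff₀ (by positivity), mul_comm]
  have key := mul_le_mul_of_forall_one_sub_pow (k := finrank ℝ A.direction + 1) (c := n + 1)
    (M := volume.real U) (B := volume.real (U ∩ G)) (by positivity) measureReal_nonneg
    ?_ measureReal_nonneg
  · simpa [Measure.real] using key
  · intro s hs0 hs1
    have h := pow_mul_measure_le_of_mem_affineSubspace volume hbd hcent' A
      (I := I) (fun i hi => (Finset.mem_filter.1 hi).2) hA hs0 hs1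
    have hd : volume.real (U \ G) = volume.real U - volume.real (U ∩ G) := by
      rw [eq_sub_iff_add_eq, measureReal_sdiff_add_inter hGm hUfin]
    have h' := ENNReal.toReal_mono (ENNReal.add_ne_top.2
      ⟨measure_ne_top_of_subset Set.sdiff_subset hUfin, ENNReal.mul_ne_top ENNReal.ofReal_ne_top
        (measure_ne_top_of_subset Set.inter_subset_left hUfin)⟩) h
    rw [ENNReal.toReal_mul, ENNReal.toReal_add (measure_ne_top_of_subset Set.sdiff_subset hUfin)
      (ENNReal.mul_ne_top ENNReal.ofReal_ne_top
        (measure_ne_top_of_subset Set.inter_subset_left hUfin)), ENNReal.toReal_mul,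
      ENNReal.toReal_ofReal (pow_nonneg (by linarith) _),
      ENNReal.toReal_ofReal (Real.exp_pos _).le, finrank_euclideanSpace_fin] at h'
    rw [← hd]
    exact h'
end

section
/- Let P = {x ∈ ℝⁿ : ⟨a_i, x⟩ ≤ 1, 1 ≤ i ≤ m} be a centered n-dimensional polytope (irredundant description, 0 ∈ int P) and fix an index i. Then vol(C_i) = (1/(n+1)) · vol(P) holds if and only if P is a pyramid with base F_i, i.e., P = conv(F_i ∪ {v}) for some point v ∉ aff F_i. Moreover, in all cases vol(C_i) ≤ (1/(n+1)) · vol(P). -/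
open MeasureTheory Module
open scoped RealInnerProductSpace

section

open Set ENNReal
open scoped Pointwise

theorem IsCompact.volume_add_le_of_forall_add_mem {A B C : Set ℝ} (hA : IsCompact A)
    (hB : IsCompact B) (hAne : A.Nonempty) (hBne : B.Nonempty)
    (h : ∀ a ∈ A, ∀ b ∈ B, a + b ∈ C) : volume A + volume B ≤ volume C := by
  obtain ⟨p, hpA, hp⟩ := hA.exists_isGreatest hAne
  obtain ⟨q, hqB, hq⟩ := hB.exists_isLeast hBne
  have hd : AEDisjoint volume ((fun x => q + x) '' A) ((fun x => p + x) '' B) := by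
    refine measure_mono_null (t := {p + q}) ?_ (by simp)
    rintro _ ⟨⟨a, ha, rfl⟩, ⟨b, hb, hab⟩⟩
    have h1 := hp ha
    have h2 := hq hb
    simp only [mem_singleton_iff] at *
    linarith
  calc volume A + volume B
      = volume ((fun x => q + x) '' A) + volume ((fun x => p + x) '' B) := by
        simp only [image_add_left, measure_preimage_add]
    _ = volume (((fun x => q + x) '' A) ∪ ((fun x => p + x) '' B)) := by
        refine (measure_union₀ ?_ hd).symm
        exact (hB.image (by fun_prop)).measurableSet.nullMeasurableSet
    _ ≤ volume C := by
        refine measure_mono ?_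
        rintro _ (⟨a, ha, rfl⟩ | ⟨b, hb, rfl⟩)
        · simpa [add_comm] using h a ha q hqB
        · exact h p hpA b hb

/-- The one-dimensional Brunn–Minkowski inequality. -/
theorem volume_add_le_of_forall_add_mem {A B C : Set ℝ} (hA : MeasurableSet A)
    (hB : MeasurableSet B) (hAne : A.Nonempty) (hBne : B.Nonempty)
    (h : ∀ a ∈ A, ∀ b ∈ B, a + b ∈ C) : volume A + volume B ≤ volume C := by
  obtain ⟨p, hp⟩ := hAne
  obtain ⟨q, hq⟩ := hBne
  rw [hA.measure_eq_iSup_isCompact, hB.measure_eq_iSup_isCompact]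
  simp only [iSup_and']
  refine ENNReal.biSup_add_biSup_le' (p := fun K => K ⊆ A ∧ IsCompact K)
    (q := fun K => K ⊆ B ∧ IsCompact K) ⟨∅, by simp⟩ ⟨∅, by simp⟩ ?_
  rintro K ⟨hKA, hK⟩ L ⟨hLB, hL⟩
  calc volume K + volume L ≤ volume (insert p K) + volume (insert q L) := by
        gcongr <;> exact subset_insert _ _
    _ ≤ volume C := (hK.insert p).volume_add_le_of_forall_add_mem (hL.insert q)
        (insert_nonempty _ _) (insert_nonempty _ _) fun a ha b hb =>
          h a (insert_subset hp hKA ha) b (insert_subset hq hLB hb)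

theorem ENNReal.geom_mean_le_arith_mean2_weighted {s : ℝ} (hs0 : 0 < s) (hs1 : s < 1)
    (x y : ℝ≥0∞) :
    x ^ (1 - s) * y ^ s ≤ ENNReal.ofReal (1 - s) * x + ENNReal.ofReal s * y := by
  have hs1' : 0 < 1 - s := by linarith
  rcases eq_or_ne x ⊤ with rfl | hx
  · rw [ENNReal.mul_top (by simpa using hs1)]; simp
  rcases eq_or_ne y ⊤ with rfl | hy
  · rw [ENNReal.mul_top (by simpa using hs0)]; simp
  rw [← ENNReal.ofReal_toReal hx, ← ENNReal.ofReal_toReal hy,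
    ENNReal.ofReal_rpow_of_nonneg toReal_nonneg hs1'.le,
    ENNReal.ofReal_rpow_of_nonneg toReal_nonneg hs0.le, ← ENNReal.ofReal_mul (by positivity),
    ← ENNReal.ofReal_mul (by positivity), ← ENNReal.ofReal_mul (by positivity),
    ← ENNReal.ofReal_add (by positivity) (by positivity)]
  exact ENNReal.ofReal_le_ofReal (Real.geom_mean_le_arith_mean2_weighted hs1'.le hs0.le
    toReal_nonneg toReal_nonneg (by ring))

/-- The Prékopa–Leindler inequality on the line, for functions with supremum one. -/
theorem lintegral_rpow_mul_lintegral_rpow_le_of_isLUB_one {f g h : ℝ → ℝ} (hf : Measurable f)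
    (hg : Measurable g) (hh : Measurable h) (hf0 : ∀ x, 0 ≤ f x) (hg0 : ∀ x, 0 ≤ g x)
    (hf1 : IsLUB (range f) 1) (hg1 : IsLUB (range g) 1) {s : ℝ} (hs0 : 0 < s) (hs1 : s < 1)
    (H : ∀ x y, f x ^ (1 - s) * g y ^ s ≤ h ((1 - s) * x + s * y)) (hh0 : ∀ x, 0 ≤ h x) :
    (∫⁻ x, ENNReal.ofReal (f x)) ^ (1 - s) * (∫⁻ x, ENNReal.ofReal (g x)) ^ s
      ≤ ∫⁻ x, ENNReal.ofReal (h x) := by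
  have hs1' : 0 < 1 - s := by linarith
  refine (ENNReal.geom_mean_le_arith_mean2_weighted hs0 hs1 _ _).trans ?_
  rw [lintegral_eq_lintegral_meas_lt volume (ae_of_all _ hf0) hf.aemeasurable,
    lintegral_eq_lintegral_meas_lt volume (ae_of_all _ hg0) hg.aemeasurable,
    lintegral_eq_lintegral_meas_lt volume (ae_of_all _ hh0) hh.aemeasurable,
    ← lintegral_const_mul' _ _ ofReal_ne_top, ← lintegral_const_mul' _ _ ofReal_ne_top,
    ← lintegral_add_left']
  swap
  · refine (Measurable.const_mul ?_ _).aemeasurable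
    exact Antitone.measurable fun t u htu => measure_mono fun x (hx : u < f x) => htu.trans_lt hx
  refine setLIntegral_mono' measurableSet_Ioi fun t (ht : 0 < t) => ?_
  rcases le_or_gt 1 t with h1 | h1
  · have e1 : {a | t < f a} = ∅ := by
      ext x; simpa using (hf1.1 ⟨x, rfl⟩).trans h1
    have e2 : {a | t < g a} = ∅ := by
      ext x; simpa using (hg1.1 ⟨x, rfl⟩).trans h1
    simp [e1, e2]
  · obtain ⟨_, ⟨p, rfl⟩, hp, -⟩ := hf1.exists_between h1
    obtain ⟨_, ⟨q, rfl⟩, hq, -⟩ := hg1.exists_between h1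
    have key : ∀ (r : ℝ) (hr : 0 < r) (A : Set ℝ),
        ENNReal.ofReal r * volume A = volume ((fun x => r * x) '' A) := by
      intro r hr A
      have := Measure.addHaar_smul_of_nonneg (volume : Measure ℝ) hr.le A
      simpa [← image_smul] using this.symm
    have km : ∀ (r : ℝ) (hr : 0 < r) (A : Set ℝ), MeasurableSet A →
        MeasurableSet ((fun x => r * x) '' A) := fun r hr A hA =>
      (Homeomorph.mulLeft₀ r hr.ne').measurableEmbedding.measurableSet_image.2 hA
    rw [key _ hs1', key _ hs0]
    refine volume_add_le_of_forall_add_mem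
      (km _ hs1' _ (measurableSet_lt measurable_const hf))
      (km _ hs0 _ (measurableSet_lt measurable_const hg))
      (Nonempty.image _ ⟨p, hp⟩) (Nonempty.image _ ⟨q, hq⟩) ?_
    rintro _ ⟨x, hx, rfl⟩ _ ⟨y, hy, rfl⟩
    refine lt_of_lt_of_le ?_ (H x y)
    calc t = t ^ (1 - s) * t ^ s := by rw [← Real.rpow_add ht]; simp
      _ < f x ^ (1 - s) * g y ^ s :=
        mul_lt_mul'' (Real.rpow_lt_rpow ht.le hx hs1') (Real.rpow_lt_rpow ht.le hy hs0)
          (by positivity) (by positivity)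

/-- The Prékopa–Leindler inequality on the line, for bounded functions. -/
theorem lintegral_rpow_mul_lintegral_rpow_le {f g h : ℝ → ℝ} (hf : Measurable f)
    (hg : Measurable g) (hh : Measurable h) (hf0 : ∀ x, 0 ≤ f x) (hg0 : ∀ x, 0 ≤ g x)
    (hfb : BddAbove (range f)) (hgb : BddAbove (range g)) {s : ℝ} (hs0 : 0 < s) (hs1 : s < 1)
    (H : ∀ x y, f x ^ (1 - s) * g y ^ s ≤ h ((1 - s) * x + s * y)) (hh0 : ∀ x, 0 ≤ h x) :
    (∫⁻ x, ENNReal.ofReal (f x)) ^ (1 - s) * (∫⁻ x, ENNReal.ofReal (g x)) ^ s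
      ≤ ∫⁻ x, ENNReal.ofReal (h x) := by
  have hs1' : 0 < 1 - s := by linarith
  have hfS := isLUB_csSup (range_nonempty f) hfb
  have hgT := isLUB_csSup (range_nonempty g) hgb
  set S := sSup (range f)
  set T := sSup (range g)
  have hS0 : 0 ≤ S := (hf0 0).trans (hfS.1 ⟨0, rfl⟩)
  have hT0 : 0 ≤ T := (hg0 0).trans (hgT.1 ⟨0, rfl⟩)
  rcases hS0.eq_or_lt with hS | hS
  · have : ∀ x, f x = 0 := fun x => le_antisymm (hS ▸ hfS.1 ⟨x, rfl⟩) (hf0 x)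
    simp [this, hs1]
  rcases hT0.eq_or_lt with hT | hT
  · have : ∀ x, g x = 0 := fun x => le_antisymm (hT ▸ hgT.1 ⟨x, rfl⟩) (hg0 x)
    simp [this, hs0]
  have lub : ∀ (u : ℝ → ℝ) (U : ℝ), 0 < U → IsLUB (range u) U →
      IsLUB (range fun x => U⁻¹ * u x) 1 := by
    intro u U hU hu
    constructor
    · rintro _ ⟨x, rfl⟩
      have := hu.1 ⟨x, rfl⟩
      change U⁻¹ * u x ≤ 1
      rw [inv_mul_le_iff₀ hU]; simpa using this
    · intro b hb
      have : U ≤ U * b := hu.2 (by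
        rintro _ ⟨x, rfl⟩
        exact (inv_mul_le_iff₀ hU).1 (hb ⟨x, rfl⟩))
      nlinarith
  have hW : 0 < S ^ (1 - s) * T ^ s := by positivity
  have main := lintegral_rpow_mul_lintegral_rpow_le_of_isLUB_one (f := fun x => S⁻¹ * f x)
    (g := fun x => T⁻¹ * g x) (h := fun x => (S ^ (1 - s) * T ^ s)⁻¹ * h x)
    (hf.const_mul _) (hg.const_mul _) (hh.const_mul _)
    (fun x => mul_nonneg (by positivity) (hf0 x)) (fun x => mul_nonneg (by positivity) (hg0 x))
    (lub f S hS hfS) (lub g T hT hgT) hs0 hs1 (fun x y => by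
      rw [Real.mul_rpow (by positivity) (hf0 x), Real.mul_rpow (by positivity) (hg0 y),
        Real.inv_rpow hS0, Real.inv_rpow hT0, mul_inv]
      have := mul_le_mul_of_nonneg_left (H x y) (inv_nonneg.2 hW.le)
      rw [mul_inv] at this
      linarith)
    (fun x => mul_nonneg (by positivity) (hh0 x))
  have pull : ∀ (c : ℝ) (hc : 0 ≤ c) (u : ℝ → ℝ),
      ∫⁻ x, ENNReal.ofReal (c * u x) = ENNReal.ofReal c * ∫⁻ x, ENNReal.ofReal (u x) := by
    intro c hc u
    rw [← lintegral_const_mul' _ _ ofReal_ne_top]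
    simp_rw [ENNReal.ofReal_mul hc]
  rw [pull _ (by positivity), pull _ (by positivity), pull _ (by positivity),
    ENNReal.mul_rpow_of_nonneg _ _ hs1'.le, ENNReal.mul_rpow_of_nonneg _ _ hs0.le,
    ENNReal.ofReal_rpow_of_nonneg (by positivity) hs1'.le,
    ENNReal.ofReal_rpow_of_nonneg (by positivity) hs0.le, mul_mul_mul_comm,
    ← ENNReal.ofReal_mul (by positivity), Real.inv_rpow hS0, Real.inv_rpow hT0,
    ← mul_inv] at main
  refine (ENNReal.mul_le_mul_iff_right ?_ ofReal_ne_top).1 main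
  exact (ENNReal.ofReal_pos.2 (inv_pos.2 hW)).ne'

/-- The multiplicative form of the Brunn–Minkowski inequality. -/
theorem volume_rpow_mul_volume_rpow_le {s : ℝ} (hs0 : 0 < s) (hs1 : s < 1) (n : ℕ) :
    ∀ {A B C : Set (Fin n → ℝ)}, MeasurableSet A → MeasurableSet B → MeasurableSet C →
    Bornology.IsBounded A → Bornology.IsBounded B → Bornology.IsBounded C →
    (∀ x ∈ A, ∀ y ∈ B, (1 - s) • x + s • y ∈ C) →
    volume A ^ (1 - s) * volume B ^ s ≤ volume C := by
  have hs1' : 0 < 1 - s := by linarith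
  induction n with
  | zero =>
    intro A B C _ _ _ _ _ _ H
    rcases A.eq_empty_or_nonempty with rfl | ⟨x, hx⟩
    · simp [hs1]
    rcases B.eq_empty_or_nonempty with rfl | ⟨y, hy⟩
    · simp [hs0]
    have := H x hx y hy
    rw [Subsingleton.eq_univ_of_nonempty ⟨x, hx⟩, Subsingleton.eq_univ_of_nonempty ⟨y, hy⟩,
      Subsingleton.eq_univ_of_nonempty ⟨_, this⟩]
    simp [volume_pi]
  | succ n ih =>
    intro A B C hA hB hC hAb hBb hCb H
    let e := MeasurableEquiv.piFinSuccAbove (fun _ : Fin (n + 1) => ℝ) 0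
    let sl : Set (Fin (n + 1) → ℝ) → ℝ → Set (Fin n → ℝ) := fun A t =>
      {z | (Fin.cons t z : Fin (n + 1) → ℝ) ∈ A}
    have es : ∀ p : ℝ × (Fin n → ℝ), e.symm p = Fin.cons p.1 p.2 := fun p => by
      simp [e, Fin.insertNthEquiv]
    have hm : ∀ A, MeasurableSet A → MeasurableSet (e.symm ⁻¹' A) := fun A hA =>
      e.symm.measurable hA
    have slm : ∀ A, MeasurableSet A → ∀ t, MeasurableSet (sl A t) := by
      intro A hA t
      have := measurable_prodMk_left (x := t) (hm A hA)
      simpa only [preimage, mem_ofPred_eq, es] using this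
    have slb : ∀ A, Bornology.IsBounded A → ∃ R, ∀ t, sl A t ⊆ Metric.closedBall 0 R := by
      intro A hA
      obtain ⟨R, hR⟩ := hA.subset_closedBall 0
      refine ⟨R, fun t z hz => ?_⟩
      have h1 := hR hz
      rw [mem_closedBall_zero_iff] at h1 ⊢
      have hR0 : 0 ≤ R := (norm_nonneg _).trans h1
      rw [pi_norm_le_iff_of_nonneg hR0] at h1 ⊢
      intro i
      simpa using h1 i.succ
    have slv : ∀ A, MeasurableSet A → Bornology.IsBounded A →
        volume A = ∫⁻ t, ENNReal.ofReal (volume.real (sl A t)) := by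
      intro A hA hAb
      have h1 := (volume_preserving_piFinSuccAbove
        (fun _ : Fin (n + 1) => ℝ) 0).symm.measure_preimage hA.nullMeasurableSet
      rw [← h1, Measure.volume_eq_prod, Measure.prod_apply (hm A hA)]
      refine lintegral_congr fun t => ?_
      obtain ⟨R, hR⟩ := slb A hAb
      rw [ofReal_measureReal (measure_ne_top_of_subset (hR t) measure_closedBall_lt_top.ne)]
      congr 1
      ext z
      simp only [sl, preimage, mem_ofPred_eq]
      exact iff_of_eq (congrArg (· ∈ A) (es (t, z)))
    have slme : ∀ A, MeasurableSet A → Measurable fun t => volume.real (sl A t) := by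
      intro A hA
      refine Measurable.ennreal_toReal ?_
      have := measurable_measure_prodMk_left (ν := (volume : Measure (Fin n → ℝ))) (hm A hA)
      simpa only [preimage, mem_ofPred_eq, es] using this
    have slbd : ∀ A, Bornology.IsBounded A → BddAbove (range fun t => volume.real (sl A t)) := by
      intro A hA
      obtain ⟨R, hR⟩ := slb A hA
      refine ⟨volume.real (Metric.closedBall (0 : Fin n → ℝ) R), ?_⟩
      rintro _ ⟨t, rfl⟩
      exact measureReal_mono (hR t) measure_closedBall_lt_top.ne
    rw [slv A hA hAb, slv B hB hBb, slv C hC hCb]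
    refine lintegral_rpow_mul_lintegral_rpow_le (slme A hA) (slme B hB) (slme C hC)
      (fun _ => measureReal_nonneg) (fun _ => measureReal_nonneg) (slbd A hAb) (slbd B hBb)
      hs0 hs1 ?_ (fun _ => measureReal_nonneg)
    intro t u
    have bd : ∀ A, Bornology.IsBounded A → ∀ t, Bornology.IsBounded (sl A t) := fun A hA t =>
      let ⟨_, hR⟩ := slb A hA
      Metric.isBounded_closedBall.subset (hR t)
    have := ih (slm A hA t) (slm B hB u) (slm C hC ((1 - s) * t + s * u)) (bd A hAb t)
      (bd B hBb u) (bd C hCb _) (by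
        intro x hx y hy
        have := H _ hx _ hy
        change Fin.cons _ _ ∈ C
        convert this using 1
        ext i
        refine Fin.cases ?_ (fun j => ?_) i <;> simp)
    have := ENNReal.toReal_mono (bd C hCb _).measure_lt_top.ne this
    rwa [ENNReal.toReal_mul, ← ENNReal.toReal_rpow, ← ENNReal.toReal_rpow] at this

/-- The Brunn–Minkowski inequality in Euclidean space. -/
theorem add_pow_le_volume {n : ℕ} {A B C : Set (EuclideanSpace ℝ (Fin n))}
    (hA : MeasurableSet A) (hB : MeasurableSet B) (hC : MeasurableSet C)
    (hAb : Bornology.IsBounded A) (hBb : Bornology.IsBounded B) (hCb : Bornology.IsBounded C)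
    {s : ℝ} (hs0 : 0 < s) (hs1 : s < 1) (H : ∀ x ∈ A, ∀ y ∈ B, (1 - s) • x + s • y ∈ C)
    {α β : ℝ} (hα : 0 < α) (hβ : 0 < β) (hvA : volume.real A = α ^ n)
    (hvB : volume.real B = β ^ n) :
    ((1 - s) * α + s * β) ^ n ≤ volume.real C := by
  have hs1' : 0 < 1 - s := by linarith
  set σ := (1 - s) * α + s * β with hσ
  have hσ0 : 0 < σ := by positivity
  set ι : (Fin n → ℝ) → EuclideanSpace ℝ (Fin n) := WithLp.toLp 2 with hι
  have mp : MeasurePreserving ι := PiLp.volume_preserving_toLp (Fin n)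
  have lip : ∀ A : Set (EuclideanSpace ℝ (Fin n)), Bornology.IsBounded A →
      Bornology.IsBounded (ι ⁻¹' A) := fun A hA => by
    have := (PiLp.lipschitzWith_ofLp 2 (fun _ : Fin n => ℝ)).isBounded_image hA
    refine this.subset fun x hx => ⟨ι x, hx, rfl⟩
  let D : ℝ → Set (EuclideanSpace ℝ (Fin n)) → Set (Fin n → ℝ) := fun r A =>
    (fun x => r • x) ⁻¹' (ι ⁻¹' A)
  have Dm : ∀ r A, MeasurableSet A → MeasurableSet (D r A) := fun r A hA =>
    measurable_const_smul r (mp.measurable hA)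
  have Deq : ∀ r (hr : 0 < r) A, D r A = r⁻¹ • (ι ⁻¹' A) := fun r hr A =>
    preimage_smul₀ hr.ne' _
  have Db : ∀ r, 0 < r → ∀ A, Bornology.IsBounded A → Bornology.IsBounded (D r A) := by
    intro r hr A hA
    rw [Deq r hr]
    exact (lip A hA).smul₀ _
  have Dv : ∀ r, 0 < r → ∀ A, MeasurableSet A →
      (volume (D r A)).toReal = (r ^ n)⁻¹ * volume.real A := by
    intro r hr A hA
    rw [Deq r hr, Measure.addHaar_smul_of_nonneg _ (by positivity),
      mp.measure_preimage hA.nullMeasurableSet, toReal_mul, toReal_ofReal (by positivity)]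
    simp [Measure.real]
  have key := volume_rpow_mul_volume_rpow_le (s := s * β / σ) (by positivity)
    ((div_lt_one hσ0).2 (by rw [hσ]; nlinarith)) n (Dm α A hA) (Dm β B hB) (Dm σ C hC)
    (Db α hα A hAb) (Db β hβ B hBb) (Db σ hσ0 C hCb) (by
      intro x hx y hy
      have := H _ hx _ hy
      change ι (σ • _) ∈ C
      convert this using 1
      have e1 : σ * (1 - s * β / σ) = (1 - s) * α := by field_simp; rw [hσ]; ring
      have e2 : σ * (s * β / σ) = s * β := by field_simp
      simp only [hι, smul_add, smul_smul, e1, e2, WithLp.toLp_add, WithLp.toLp_smul])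
  have key := ENNReal.toReal_mono (Db σ hσ0 C hCb).measure_lt_top.ne key
  rw [ENNReal.toReal_mul, ← ENNReal.toReal_rpow, ← ENNReal.toReal_rpow, Dv α hα A hA,
    Dv β hβ B hB, Dv σ hσ0 C hC, hvA, hvB, inv_mul_cancel₀ (by positivity),
    inv_mul_cancel₀ (by positivity), Real.one_rpow, Real.one_rpow, one_mul,
    le_inv_mul_iff₀ (by positivity), mul_one] at key
  exact key

section

variable {n : ℕ} {a : EuclideanSpace ℝ (Fin n)} {P : Set (EuclideanSpace ℝ (Fin n))}

theorem volume_real_convexHull_union_singleton {F : Set (EuclideanSpace ℝ (Fin n))}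
    (hF : ∀ x ∈ F, ⟪a, x⟫ = 1) {v : EuclideanSpace ℝ (Fin n)} (hv : ⟪a, v⟫ ≤ 1) :
    volume.real (convexHull ℝ (F ∪ {v})) =
      (1 - ⟪a, v⟫) * volume.real (convexHull ℝ ({0} ∪ F)) := by
  set T := LinearMap.transvection (-(innerₛₗ ℝ a)) v with hT
  have hTx : ∀ x, T x = x - ⟪a, x⟫ • v := fun x => by
    simp [hT, LinearMap.transvection.apply, sub_eq_add_neg]
  have himg : F ∪ {v} = v +ᵥ T '' ({0} ∪ F) := by
    rw [image_union, image_singleton, map_zero, vadd_set_union, union_comm]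
    congr 1
    · simp
    · ext x
      simp only [← image_vadd, image_image, mem_image]
      constructor
      · exact fun hx => ⟨x, hx, by simp [hTx, hF x hx]⟩
      · rintro ⟨y, hy, rfl⟩
        simpa [hTx, hF y hy] using hy
  rw [himg, convexHull_vadd, ← LinearMap.image_convexHull, Measure.real, measure_vadd,
    Measure.addHaar_image_linearMap, ENNReal.toReal_mul, LinearMap.transvection.det]
  simp only [LinearMap.neg_apply, innerₛₗ_apply_apply]
  rw [abs_of_nonneg (by linarith), ENNReal.toReal_ofReal (by linarith), Measure.real]
  ring

theorem IsCompact.convexHull_union_singleton {F : Set (EuclideanSpace ℝ (Fin n))}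
    (hF : IsCompact F) (hconv : Convex ℝ F) (hne : F.Nonempty)
    (v : EuclideanSpace ℝ (Fin n)) : IsCompact (convexHull ℝ (F ∪ {v})) := by
  have : convexHull ℝ (F ∪ {v}) =
      (fun p : ℝ × EuclideanSpace ℝ (Fin n) => AffineMap.lineMap v p.2 p.1) ''
        Icc (0 : ℝ) 1 ×ˢ F := by
    ext x
    rw [union_singleton, convexHull_insert hne, hconv.convexHull_eq, mem_convexJoin]
    simp only [mem_singleton_iff, exists_eq_left, segment_eq_image_lineMap, mem_image,
      Prod.exists, mem_prod]
    grind
  rw [this]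
  refine (isCompact_Icc.prod hF).image ?_
  simp only [AffineMap.lineMap_apply]
  fun_prop

theorem volume_real_inter_add_le (hconv : Convex ℝ P) (hcomp : IsCompact P) (h0 : 0 ∈ P)
    (hne : (P ∩ {x | ⟪a, x⟫ = 1}).Nonempty) {τ : ℝ} (hτ1 : τ < 1) :
    volume.real (P ∩ {x | τ ≤ 1 - ⟪a, x⟫}) + (1 - (1 - τ) ^ n) *
      volume.real (convexHull ℝ ({0} ∪ (P ∩ {x | ⟪a, x⟫ = 1}))) ≤ volume.real P := by
  set F := P ∩ {x | ⟪a, x⟫ = 1} with hFdef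
  set C := convexHull ℝ ({0} ∪ F) with hC
  have hτ : 0 < 1 - τ := by linarith
  have hFconv : Convex ℝ F := hconv.inter (convex_hyperplane (innerₛₗ ℝ a).isLinear 1)
  have hCP : C ⊆ P := convexHull_min (union_subset (by simpa using h0) inter_subset_left) hconv
  have hpt : ∀ x ∈ C, ∃ r : ℝ, 0 ≤ r ∧ r ≤ 1 ∧ ∃ f ∈ F, x = r • f := by
    intro x hx
    rw [hC, singleton_union, convexHull_insert hne, hFconv.convexHull_eq, mem_convexJoin] at hx
    obtain ⟨p, hp, f, hf, p', q', hp', hq', hpq, rfl⟩ := hx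
    obtain rfl : p = 0 := hp
    exact ⟨q', hq', by linarith, f, hf, by simp⟩
  have hPfin : volume P ≠ ⊤ := hcomp.measure_lt_top.ne
  set Q := P ∩ {x | τ ≤ 1 - ⟪a, x⟫} with hQ
  have hQm : MeasurableSet Q :=
    hcomp.measurableSet.inter (measurableSet_le measurable_const (by fun_prop))
  have hsub : C ∩ Q ⊆ (1 - τ) • C := by
    rintro x ⟨hx, -, hxτ⟩
    obtain ⟨r, hr0, hr1, f, hf, rfl⟩ := hpt x hx
    have hrf : r ≤ 1 - τ := by
      have h1 : ⟪a, f⟫ = 1 := hf.2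
      have h2 : τ ≤ 1 - ⟪a, r • f⟫ := hxτ
      rw [inner_smul_right, h1] at h2
      linarith
    refine ⟨(r / (1 - τ)) • f, ?_, by simp only [smul_smul]; congr 1; field_simp⟩
    have hz : (0 : EuclideanSpace ℝ (Fin n)) ∈ C := subset_convexHull ℝ _ (by simp)
    have hfC : f ∈ C := subset_convexHull ℝ _ (Or.inr hf)
    exact (convex_convexHull ℝ _).smul_mem_of_zero_mem hz hfC
      ⟨by positivity, (div_le_one hτ).2 hrf⟩
  have hCfin : volume C ≠ ⊤ := measure_ne_top_of_subset hCP hPfin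
  have h1 : volume.real (C ∩ Q) ≤ (1 - τ) ^ n * volume.real C := by
    have h2 := measureReal_mono (μ := volume) hsub (by
      rw [Measure.addHaar_smul_of_nonneg _ hτ.le]
      exact ENNReal.mul_ne_top ENNReal.ofReal_ne_top hCfin)
    rw [measureReal_def volume ((1 - τ) • C), Measure.addHaar_smul_of_nonneg _ hτ.le,
      ENNReal.toReal_mul, ENNReal.toReal_ofReal (by positivity)] at h2
    simpa [Measure.real] using h2
  have h3 : volume.real (C ∩ Q) + volume.real (C \ Q) = volume.real C :=
    measureReal_inter_add_sdiff hQm hCfin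
  have h4 : volume.real Q + volume.real (C \ Q) ≤ volume.real P := by
    have h5 := measureReal_inter_add_sdiff (μ := volume) (s := P) hQm hPfin
    have h6 : volume.real (C \ Q) ≤ volume.real (P \ Q) :=
      measureReal_mono (sdiff_subset_sdiff_left hCP) (measure_ne_top_of_subset sdiff_subset hPfin)
    rw [inter_eq_right.2 inter_subset_left] at h5
    linarith
  linarith

theorem volume_real_inter_le (hconv : Convex ℝ P) (hcomp : IsCompact P) (h0 : 0 ∈ P)
    (hn : n ≠ 0) (hne : (P ∩ {x | ⟪a, x⟫ = 1}).Nonempty) (ha : ∀ x ∈ P, ⟪a, x⟫ ≤ 1)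
    (hV : 0 < volume.real P) {t : ℝ} (ht : 0 ≤ t)
    (hkt : volume.real (convexHull ℝ ({0} ∪ (P ∩ {x | ⟪a, x⟫ = 1}))) / volume.real P * t ≤ 1) :
    volume.real (P ∩ {x | t ≤ 1 - ⟪a, x⟫}) ≤ volume.real P *
      (1 - volume.real (convexHull ℝ ({0} ∪ (P ∩ {x | ⟪a, x⟫ = 1}))) / volume.real P * t) ^ n := by
  set c := volume.real (convexHull ℝ ({0} ∪ (P ∩ {x | ⟪a, x⟫ = 1}))) with hc
  set V := volume.real P with hVdef
  set W := volume.real (P ∩ {x | t ≤ 1 - ⟪a, x⟫}) with hW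
  have hc0 : 0 ≤ c := measureReal_nonneg
  have hkt' : 0 ≤ 1 - c / V * t := by linarith
  rcases (measureReal_nonneg : 0 ≤ W).eq_or_lt with hW0 | hW0
  · rw [hW, ← hW0]; positivity
  have hbd := hcomp.isBounded
  have hm : ∀ u : ℝ, MeasurableSet (P ∩ {x | u ≤ 1 - ⟪a, x⟫}) := fun u =>
    hcomp.measurableSet.inter (measurableSet_le measurable_const (by fun_prop))
  set α := V ^ ((n : ℝ)⁻¹) with hα
  set β := W ^ ((n : ℝ)⁻¹) with hβ
  have hα0 : 0 < α := by positivity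
  have hβ0 : 0 < β := by positivity
  have hαn : V = α ^ n := (Real.rpow_inv_natCast_pow hV.le hn).symm
  have hβn : W = β ^ n := (Real.rpow_inv_natCast_pow hW0.le hn).symm
  set ρ := β / α with hρ
  have hρ0 : 0 < ρ := by positivity
  have key : ∀ s : ℝ, 0 < s → s < 1 → s * t < 1 →
      c * t ≤ V * (1 - ρ) * (1 + n * (s * t)) := by
    intro s hs0 hs1 hst
    have hst0 : 0 ≤ s * t := by positivity
    have h1 := add_pow_le_volume hcomp.measurableSet (hm t) (hm (s * t)) hbd
      (hbd.subset inter_subset_left) (hbd.subset inter_subset_left) hs0 hs1 (by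
        rintro x hx y ⟨hy, hyt⟩
        refine ⟨hconv hx hy (by linarith) hs0.le (by ring), ?_⟩
        have e1 := ha x hx
        have e2 : t ≤ 1 - ⟪a, y⟫ := hyt
        change s * t ≤ 1 - ⟪a, (1 - s) • x + s • y⟫
        rw [inner_add_right, inner_smul_right, inner_smul_right]
        nlinarith) hα0 hβ0 hαn hβn
    have h2 := volume_real_inter_add_le hconv hcomp h0 hne hst
    have h3 : ((1 - s) * α + s * β) ^ n = V * (1 + s * (ρ - 1)) ^ n := by
      rw [hαn, ← mul_pow]
      congr 1
      rw [hρ]; field_simp; ring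
    have h4 : 1 + n * (s * (ρ - 1)) ≤ (1 + s * (ρ - 1)) ^ n :=
      one_add_mul_le_pow (by nlinarith) n
    have h5 : (1 - s * t) ^ n * (1 + n * (s * t)) ≤ 1 := by
      have e1 : 1 + n * (s * t) ≤ (1 + s * t) ^ n := one_add_mul_le_pow (by linarith) n
      have e2 : 0 ≤ (1 - s * t) ^ n := pow_nonneg (by linarith) n
      calc _ ≤ (1 - s * t) ^ n * (1 + s * t) ^ n := by gcongr
        _ = (1 - (s * t) ^ 2) ^ n := by rw [← mul_pow]; ring
        _ ≤ 1 := pow_le_one₀ (by nlinarith) (by nlinarith)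
    rw [h3] at h1
    have h6 : V * (1 + n * (s * (ρ - 1))) ≤ V * (1 + s * (ρ - 1)) ^ n := by gcongr
    have h7 : (1 - (1 - s * t) ^ n) * c ≤ V * (n * s * (1 - ρ)) := by linarith
    have hns : 0 < n * s := by positivity
    have hD : 0 ≤ 1 + n * (s * t) := by positivity
    have h8 := mul_le_mul_of_nonneg_right h7 hD
    have h9 := mul_le_mul_of_nonneg_left h5 hc0
    refine le_of_mul_le_mul_left ?_ hns
    linarith
  have hlim : c * t ≤ V * (1 - ρ) := by
    have ht : Filter.Tendsto (fun s : ℝ => V * (1 - ρ) * (1 + n * (s * t)))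
        (nhdsWithin 0 (Ioi 0)) (nhds (V * (1 - ρ))) := by
      have : Continuous fun s : ℝ => V * (1 - ρ) * (1 + n * (s * t)) := by fun_prop
      simpa using (this.tendsto 0).mono_left nhdsWithin_le_nhds
    refine ge_of_tendsto ht ?_
    have h1 : ∀ᶠ s : ℝ in nhds 0, s * t < 1 :=
      (continuous_id.mul continuous_const).tendsto' 0 0 (by simp) |>.eventually_lt_const one_pos
    filter_upwards [self_mem_nhdsWithin, nhdsWithin_le_nhds h1,
      nhdsWithin_le_nhds (eventually_lt_nhds one_pos)] with s hs0 hst hs1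
    exact key s hs0 hs1 hst
  have hρle : ρ ≤ 1 - c / V * t := by
    have : c / V * t = c * t / V := by ring
    rw [this]
    have := (div_le_iff₀' hV).2 hlim
    linarith
  have hWρ : W = V * ρ ^ n := by
    rw [hβn, hαn, ← mul_pow]
    congr 1
    rw [hρ]; field_simp
  rw [hWρ]
  gcongr

theorem setIntegral_eq_intervalIntegral_volume_real (hcomp : IsCompact P)
    (ha : ∀ x ∈ P, ⟪a, x⟫ ≤ 1) {b : ℝ} (hb0 : 0 ≤ b) (hb : ∀ x ∈ P, 1 - ⟪a, x⟫ ≤ b) :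
    ∫ x in P, (1 - ⟪a, x⟫) = ∫ t in (0 : ℝ)..b, volume.real (P ∩ {x | t ≤ 1 - ⟪a, x⟫}) := by
  have hInt : IntegrableOn (fun x => 1 - ⟪a, x⟫) P :=
    ContinuousOn.integrableOn_compact hcomp (by fun_prop)
  rw [hInt.integral_eq_integral_meas_le ((ae_restrict_iff' hcomp.measurableSet).2
    (ae_of_all _ fun x hx => by have := ha x hx; simp; linarith)),
    intervalIntegral.integral_of_le hb0]
  have hr : ∀ t : ℝ, (volume.restrict P).real {x | t ≤ 1 - ⟪a, x⟫} =
      volume.real (P ∩ {x | t ≤ 1 - ⟪a, x⟫}) := fun t => by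
    rw [measureReal_restrict_apply (measurableSet_le measurable_const (by fun_prop)), inter_comm]
  simp_rw [hr]
  refine (setIntegral_eq_of_subset_of_forall_sdiff_eq_zero measurableSet_Ioi
    Ioc_subset_Ioi_self ?_)
  rintro t ⟨ht0, ht⟩
  have : P ∩ {x | t ≤ 1 - ⟪a, x⟫} = ∅ := by
    ext x
    simp only [mem_inter_iff, mem_ofPred_eq, mem_empty_iff_false, iff_false, not_and, not_le]
    intro hx
    have := hb x hx
    by_contra! h
    exact ht ⟨ht0, h.trans this⟩
  simp [this]

theorem intervalIntegrable_volume_real_inter (hcomp : IsCompact P) (b : ℝ) :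
    IntervalIntegrable (fun t : ℝ => volume.real (P ∩ {x | t ≤ 1 - ⟪a, x⟫})) volume 0 b := by
  refine (Antitone.intervalIntegrable ?_)
  intro t u htu
  exact measureReal_mono (inter_subset_inter_right _ fun x (hx : u ≤ _) => htu.trans hx)
    (measure_ne_top_of_subset inter_subset_left hcomp.measure_lt_top.ne)

theorem mul_integral_one_sub_mul_pow (n : ℕ) (k b : ℝ) :
    k * (n + 1) * ∫ t in (0 : ℝ)..b, (1 - k * t) ^ n = 1 - (1 - k * b) ^ (n + 1) := by
  have : ∀ t ∈ uIcc 0 b, HasDerivAt (fun t : ℝ => -(1 - k * t) ^ (n + 1))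
      (k * (n + 1) * (1 - k * t) ^ n) t := by
    intro t _
    have h1 : HasDerivAt (fun t : ℝ => 1 - k * t) (-k) t := by
      simpa using ((hasDerivAt_id t).const_mul k).const_sub 1
    refine (h1.fun_pow (n + 1)).neg.congr_deriv ?_
    rw [Nat.add_sub_cancel]
    push_cast
    ring
  rw [← intervalIntegral.integral_const_mul,
    intervalIntegral.integral_eq_sub_of_hasDerivAt this
      (Continuous.intervalIntegrable (by fun_prop) _ _)]
  simp
  ring

theorem Convex.eq_of_subset_of_volume_real_le {Q : Set (EuclideanSpace ℝ (Fin n))}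
    (hP : Convex ℝ P) (hPint : (interior P).Nonempty) (hPfin : volume P ≠ ⊤) (hQ : IsClosed Q)
    (hQP : Q ⊆ P) (h : volume.real P ≤ volume.real Q) : P = Q := by
  refine Subset.antisymm (fun x hx => ?_) hQP
  by_contra hxQ
  have hcl : x ∈ closure (interior P) := by
    rw [hP.closure_interior_eq_closure_of_nonempty_interior hPint]
    exact subset_closure hx
  have hne : (Qᶜ ∩ interior P).Nonempty :=
    mem_closure_iff.1 hcl _ hQ.isOpen_compl hxQ
  have hpos := (hQ.isOpen_compl.inter isOpen_interior).measure_pos volume hne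
  have hd : volume (P \ Q) = 0 := by
    rw [← measureReal_eq_zero_iff (measure_ne_top_of_subset sdiff_subset hPfin),
      measureReal_sdiff hQP hQ.measurableSet hPfin]
    have := measureReal_mono (μ := volume) hQP hPfin
    linarith
  refine hpos.ne' (measure_mono_null ?_ hd)
  exact fun y hy => ⟨interior_subset hy.2, hy.1⟩

end

end

/-- For a centered `n`-dimensional polytope `P = {x | ⟪a i, x⟫ ≤ 1}`
(irredundant description, `0 ∈ int P`) and any index `i`, the cone volume
satisfies `vol(C i) ≤ vol(P)/(n+1)`, with equality if and only if `P` is a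
pyramid with base the facet `F i`, i.e. `P = conv(F i ∪ {v})` for some
`v ∉ aff (F i)`. -/
theorem cone_volume_singleton_case
    (n m : ℕ) (a : Fin m → EuclideanSpace ℝ (Fin n))
    (P : Set (EuclideanSpace ℝ (Fin n)))
    (hP : P = {x | ∀ i, ⟪a i, x⟫ ≤ 1})
    (hbd : Bornology.IsBounded P)
    (h0 : (0 : EuclideanSpace ℝ (Fin n)) ∈ interior P)
    (hinj : Function.Injective a)
    (ha0 : ∀ i, a i ≠ 0)
    (hirr : ∀ i, ∃ x, (∀ j, j ≠ i → ⟪a j, x⟫ ≤ 1) ∧ 1 < ⟪a i, x⟫)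
    (hcent : (volume P).toReal⁻¹ • (∫ x in P, x) = 0)
    (i : Fin m) :
    (volume (convexHull ℝ ({0} ∪ (P ∩ {x | ⟪a i, x⟫ = 1})))).toReal
        ≤ (1 / (n + 1 : ℝ)) * (volume P).toReal ∧
      ((volume (convexHull ℝ ({0} ∪ (P ∩ {x | ⟪a i, x⟫ = 1})))).toReal
          = (1 / (n + 1 : ℝ)) * (volume P).toReal ↔
        ∃ v : EuclideanSpace ℝ (Fin n),
          v ∉ affineSpan ℝ (P ∩ {x | ⟪a i, x⟫ = 1}) ∧
          P = convexHull ℝ ((P ∩ {x | ⟪a i, x⟫ = 1}) ∪ {v})) := by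
  have hn : n ≠ 0 := by
    rintro rfl
    exact ha0 i (Subsingleton.elim _ _)
  have hPi : P = ⋂ j, {x | ⟪a j, x⟫ ≤ 1} := by rw [hP]; ext; simp
  have hclosed : IsClosed P := by
    rw [hPi]
    exact isClosed_iInter fun j => isClosed_le (by fun_prop) continuous_const
  have hconv : Convex ℝ P := by
    rw [hPi]
    exact convex_iInter fun j => convex_halfSpace_le (innerₛₗ ℝ (a j)).isLinear 1
  have hcomp : IsCompact P := Metric.isCompact_of_isClosed_isBounded hclosed hbd
  have h0P : 0 ∈ P := interior_subset h0
  have hfin : volume P ≠ ⊤ := hcomp.measure_lt_top.ne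
  have ha : ∀ x ∈ P, ⟪a i, x⟫ ≤ 1 := fun x hx => by rw [hP] at hx; exact hx i
  have hV : 0 < volume.real P :=
    ENNReal.toReal_pos (Measure.measure_pos_of_nonempty_interior volume ⟨0, h0⟩).ne' hfin
  have hne : (P ∩ {x | ⟪a i, x⟫ = 1}).Nonempty := by
    obtain ⟨x, hx, hxi⟩ := hirr i
    have hpos : 0 < ⟪a i, x⟫ := one_pos.trans hxi
    have hxi' : ⟪a i, (⟪a i, x⟫)⁻¹ • x⟫ = 1 := by
      rw [inner_smul_right, inv_mul_cancel₀ hpos.ne']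
    refine ⟨(⟪a i, x⟫)⁻¹ • x, ?_, hxi'⟩
    rw [hP]
    intro j
    rcases eq_or_ne j i with rfl | hj
    · exact hxi'.le
    · rw [inner_smul_right, inv_mul_le_iff₀ hpos]
      linarith [hx j hj]
  have hcent' : ∫ x in P, (1 - ⟪a i, x⟫) = volume.real P := by
    have hid : IntegrableOn (fun x : EuclideanSpace ℝ (Fin n) => x) P :=
      continuousOn_id.integrableOn_compact hcomp
    have hzero : ∫ x in P, x = 0 :=
      (smul_eq_zero.1 hcent).resolve_left (inv_ne_zero hV.ne')
    have hone : IntegrableOn (fun _ : EuclideanSpace ℝ (Fin n) => (1 : ℝ)) P :=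
      integrableOn_const hfin
    rw [integral_sub hone (hid.const_inner (a i)), integral_inner hid,
      hzero]
    simp
  have hpyr := fun v => volume_real_convexHull_union_singleton (v := v)
    (a := a i) (F := P ∩ {x | ⟪a i, x⟫ = 1}) (fun x hx => hx.2)
  have hmeas := fun t : ℝ => volume_real_inter_le (t := t) hconv hcomp h0P hn hne ha hV
  have hFc : IsCompact (P ∩ {x | ⟪a i, x⟫ = 1}) :=
    hcomp.inter_right (isClosed_eq (by fun_prop) continuous_const)
  have hFconv : Convex ℝ (P ∩ {x | ⟪a i, x⟫ = 1}) :=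
    hconv.inter (convex_hyperplane (innerₛₗ ℝ (a i)).isLinear 1)
  simp only [← measureReal_def]
  set F := P ∩ {x | ⟪a i, x⟫ = 1} with hF
  set c := volume.real (convexHull ℝ ({0} ∪ F)) with hc
  set V := volume.real P with hVdef
  have hc0 : 0 ≤ c := measureReal_nonneg
  obtain ⟨v, hvP, hvmax⟩ := hcomp.exists_isMaxOn ⟨0, h0P⟩
    (f := fun x => 1 - ⟪a i, x⟫) (by fun_prop)
  set b := 1 - ⟪a i, v⟫ with hb
  have hbmax : ∀ x ∈ P, 1 - ⟪a i, x⟫ ≤ b := fun x hx => hvmax hx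
  have hb1 : 1 ≤ b := by simpa using hbmax 0 h0P
  have hb0 : 0 ≤ b := by linarith
  have hpyrP : ∀ w ∈ P, convexHull ℝ (F ∪ {w}) ⊆ P := fun w hw =>
    convexHull_min (Set.union_subset Set.inter_subset_left (by simpa using hw)) hconv
  have hbc : b * c ≤ V := by
    rw [hb, ← hpyr v (ha v hvP)]
    exact measureReal_mono (hpyrP v hvP) hfin
  have hkb : c / V * b ≤ 1 := by
    rw [div_mul_eq_mul_div, div_le_one hV]; linarith
  have hk0 : 0 ≤ c / V := by positivity
  have hmain : c / V * (n + 1) ≤ 1 - (1 - c / V * b) ^ (n + 1) := by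
    have h1 : V ≤ ∫ t in (0 : ℝ)..b, V * (1 - c / V * t) ^ n := by
      calc V = ∫ t in (0 : ℝ)..b, volume.real (P ∩ {x | t ≤ 1 - ⟪a i, x⟫}) := by
            rw [← hcent', setIntegral_eq_intervalIntegral_volume_real hcomp ha hb0 hbmax]
        _ ≤ _ := by
            refine intervalIntegral.integral_mono_on hb0
              (intervalIntegrable_volume_real_inter hcomp b)
              (Continuous.intervalIntegrable (by fun_prop) _ _) fun t ht => ?_
            exact hmeas t ht.1 ((mul_le_mul_of_nonneg_left ht.2 hk0).trans hkb)
    rw [intervalIntegral.integral_const_mul] at h1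
    have h2 : 1 ≤ ∫ t in (0 : ℝ)..b, (1 - c / V * t) ^ n :=
      le_of_mul_le_mul_left (by simpa using h1) hV
    rw [← mul_integral_one_sub_mul_pow]
    exact le_mul_of_one_le_right (by positivity) h2
  have hn1 : (0 : ℝ) < n + 1 := by positivity
  have hle : c ≤ 1 / (n + 1 : ℝ) * V := by
    have h1 : 0 ≤ (1 - c / V * b) ^ (n + 1) := pow_nonneg (by linarith) _
    have h2 : c / V * (n + 1) ≤ 1 := by linarith
    rw [div_mul_eq_mul_div, div_le_one hV] at h2
    rw [one_div_mul_eq_div, le_div_iff₀ hn1]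
    exact h2
  refine ⟨hle, fun heq => ⟨v, fun hv => ?_, ?_⟩, ?_⟩
  · have h1 : (affineSpan ℝ F : Set (EuclideanSpace ℝ (Fin n))) ⊆ {x | ⟪a i, x⟫ = 1} := by
      intro x hx
      refine affineSpan_induction (p := fun x => ⟪a i, x⟫ = 1) hx (fun x hx => hx.2) ?_
      intro r u w z hu hw hz
      simp [inner_add_right, inner_smul_right, inner_sub_right, hu, hw, hz]
    have h2 : ⟪a i, v⟫ = 1 := h1 hv
    linarith
  · have hk : c / V * (n + 1) = 1 := by rw [heq]; field_simp
    have h1 : (1 - c / V * b) ^ (n + 1) = 0 :=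
      le_antisymm (by linarith) (pow_nonneg (by linarith) _)
    have h2 : 1 - c / V * b = 0 := pow_eq_zero_iff (Nat.succ_ne_zero n) |>.1 h1
    have h3 : b * c = V := by
      field_simp at h2
      linarith
    refine hconv.eq_of_subset_of_volume_real_le ⟨0, h0⟩ hfin ?_ (hpyrP v hvP) ?_
    · exact (hFc.convexHull_union_singleton hFconv hne v).isClosed
    · rw [hpyr v (ha v hvP), ← hb, h3]
  · rintro ⟨w, hw, hPw⟩
    refine le_antisymm hle ?_
    have hwP : w ∈ P := hPw ▸ subset_convexHull ℝ _ (Or.inr rfl)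
    set H := 1 - ⟪a i, w⟫ with hH
    have hH0 : 0 < H := by
      refine lt_of_le_of_ne (by linarith [ha w hwP]) fun h => hw ?_
      refine subset_affineSpan ℝ _ ⟨hwP, ?_⟩
      change ⟪a i, w⟫ = 1
      linarith
    have hVc : V = H * c := by
      rw [hVdef, hH, ← hpyr w (ha w hwP), ← hPw]
    have hmono : ∫ t in (0 : ℝ)..H, V * (1 - H⁻¹ * t) ^ n ≤ V := by
      have hHb : H ≤ b := hbmax w hwP
      calc ∫ t in (0 : ℝ)..H, V * (1 - H⁻¹ * t) ^ n
          ≤ ∫ t in (0 : ℝ)..H, volume.real (P ∩ {x | t ≤ 1 - ⟪a i, x⟫}) := by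
            refine intervalIntegral.integral_mono_on hH0.le
              (Continuous.intervalIntegrable (by fun_prop) _ _)
              (intervalIntegrable_volume_real_inter hcomp H) fun t ht => ?_
            have hr1 : H⁻¹ * t ≤ 1 := by rw [inv_mul_le_iff₀ hH0]; simpa using ht.2
            have hr0 : 0 ≤ H⁻¹ * t := mul_nonneg (by positivity) ht.1
            have hvol : volume.real (AffineMap.homothety w (1 - H⁻¹ * t) '' P) =
                V * (1 - H⁻¹ * t) ^ n := by
              rw [measureReal_def, Measure.addHaar_image_homothety, ENNReal.toReal_mul,
                ENNReal.toReal_ofReal (abs_nonneg _), abs_of_nonneg (by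
                  exact pow_nonneg (by linarith) _), mul_comm]
              simp [hVdef, measureReal_def]
            rw [← hvol]
            refine measureReal_mono ?_ (measure_ne_top_of_subset Set.inter_subset_left hfin)
            rintro _ ⟨x, hx, rfl⟩
            rw [AffineMap.homothety_apply, vsub_eq_sub, vadd_eq_add]
            have e : (1 - H⁻¹ * t) • (x - w) + w = (1 - H⁻¹ * t) • x + (H⁻¹ * t) • w := by
              module
            rw [e]
            refine ⟨hconv hx hwP (by linarith) hr0 (by ring), ?_⟩
            have h1 := ha x hx
            change t ≤ 1 - ⟪a i, _⟫
            rw [inner_add_right, inner_smul_right, inner_smul_right]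
            have h2 : ⟪a i, w⟫ = 1 - H := by rw [hH]; ring
            have h3 : H⁻¹ * t * H = t := by field_simp
            rw [h2]
            nlinarith [mul_nonneg (sub_nonneg.2 hr1) (sub_nonneg.2 h1)]
        _ ≤ ∫ t in (0 : ℝ)..b, volume.real (P ∩ {x | t ≤ 1 - ⟪a i, x⟫}) :=
            intervalIntegral.integral_mono_interval le_rfl hH0.le hHb
              (Filter.Eventually.of_forall fun _ => measureReal_nonneg)
              (intervalIntegrable_volume_real_inter hcomp b)
        _ = V := by
            rw [← setIntegral_eq_intervalIntegral_volume_real hcomp ha hb0 hbmax, hcent']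
    rw [intervalIntegral.integral_const_mul] at hmono
    have h2 : ∫ t in (0 : ℝ)..H, (1 - H⁻¹ * t) ^ n ≤ 1 :=
      le_of_mul_le_mul_left (by simpa using hmono) hV
    have h3 := mul_integral_one_sub_mul_pow n H⁻¹ H
    rw [inv_mul_cancel₀ hH0.ne', sub_self, zero_pow (Nat.succ_ne_zero n), sub_zero] at h3
    have h4 : 1 ≤ H⁻¹ * (n + 1) := by
      have h5 : 0 ≤ H⁻¹ * (n + 1) := by positivity
      exact h3.ge.trans (mul_le_of_le_one_right h5 h2)
    rw [le_inv_mul_iff₀ hH0, mul_one] at h4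
    rw [one_div_mul_eq_div, div_le_iff₀ hn1, hVc]
    nlinarith
end
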